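/- Let Λ be a nonzero artin algebra. Then the following are equivalent: (i) Λ is of finite representation type, i.e., there are only finitely many isomorphism classes of indecomposable finitely generated Λ-modules; (ii) the set of GR measures for Λ is finite; (iii) some GR segment for Λ is finite; (iv) there is exactly one GR segment for Λ. -/

import Mathlib

/-- The Gabriel–Roiter total order on sets of natural numbers: `I ≺ J` iff
`I ≠ J` and the least element of the symmetric difference belongs to `J`.
(All sets occurring as Gabriel–Roiter measures consist of positive integers.) -/
def GRlt (I J : Set ℕ) : Prop :=
  I ≠ J ∧ ∃ m ∈ (I \ J) ∪ (J \ I), (∀ k ∈ (I \ J) ∪ (J \ I), m ≤ k) ∧ m ∈ J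

/-- `I ≼ J` iff `I = J` or `I ≺ J`. -/
def GRle (I J : Set ℕ) : Prop := I = J ∨ GRlt I J

/-- A module is indecomposable if it is nonzero and is not the internal direct
sum of two nonzero submodules. -/
def IsIndecomposableModule (Λ : Type*) [Ring Λ] (M : Type*) [AddCommGroup M]
    [Module Λ M] : Prop :=
  (⊤ : Submodule Λ M) ≠ ⊥ ∧
    ¬ ∃ A B : Submodule Λ M, A ≠ ⊥ ∧ B ≠ ⊥ ∧ IsCompl A B

open Classical in
/-- The (composition series) length `|M|` of a finite length module `M`,
defined via a composition series from `⊥` to `⊤` (any two such have the same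
length by the Jordan–Hölder theorem); it is `0` if no such series exists. -/
noncomputable def mlen (Λ : Type*) [Ring Λ] (M : Type*) [AddCommGroup M]
    [Module Λ M] : ℕ :=
  if h : ∃ s : CompositionSeries (Submodule Λ M), s.head = ⊥ ∧ s.last = ⊤ then
    h.choose.length
  else 0

/-- The collection of subsets of `ℕ` of the form `{|M₁|, …, |M_t|}` where
`M₁ ⊂ M₂ ⊂ ⋯ ⊂ M_t` ranges over (finite, nonempty) chains of indecomposable
submodules of `M`. -/
def grChainSets (Λ : Type*) [Ring Λ] (M : Type*) [AddCommGroup M]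
    [Module Λ M] : Set (Set ℕ) :=
  { S | ∃ (t : ℕ) (c : Fin (t + 1) → Submodule Λ M), StrictMono c ∧
      (∀ i, IsIndecomposableModule Λ (c i)) ∧
      S = Set.range fun i => mlen Λ (c i) }

open Classical in
/-- The Gabriel–Roiter measure `μ(M)`: the maximum, with respect to the total
order `≺`, of the sets of lengths of chains of indecomposable submodules of
`M` (and `∅` if this maximum does not exist, e.g. for `M = 0`). -/
noncomputable def grMeasure (Λ : Type*) [Ring Λ] (M : Type*) [AddCommGroup M]
    [Module Λ M] : Set ℕ :=
  if h : ∃ S, S ∈ grChainSets Λ M ∧ ∀ S' ∈ grChainSets Λ M, GRle S' S then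
    h.choose
  else ∅
universe u

/-- A bundled `Λ`-module (in the same universe as `Λ`). -/
structure BundledMod (Λ : Type u) [Ring Λ] : Type (u + 1) where
  carrier : Type u
  [isAddCommGroup : AddCommGroup carrier]
  [isModule : Module Λ carrier]

attribute [instance] BundledMod.isAddCommGroup BundledMod.isModule

/-- `Λ` has finite representation type: there are only finitely many
isomorphism classes of indecomposable finitely generated `Λ`-modules, i.e.
there is a finite list of modules such that every indecomposable finitely
generated `Λ`-module is isomorphic to one of them. -/
def HasFiniteRepType (Λ : Type u) [Ring Λ] : Prop :=
  ∃ (n : ℕ) (rep : Fin n → BundledMod Λ),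
    ∀ (M : Type u) (_ : AddCommGroup M) (_ : Module Λ M),
      Module.Finite Λ M → IsIndecomposableModule Λ M →
        ∃ i, Nonempty (M ≃ₗ[Λ] (rep i).carrier)

/-- `I` is a Gabriel–Roiter measure for `Λ` if `I = μ(M)` for some
indecomposable finitely generated `Λ`-module `M`. -/
def IsGRMeasureOf (Λ : Type u) [Ring Λ] (I : Set ℕ) : Prop :=
  ∃ (M : Type u) (_ : AddCommGroup M) (_ : Module Λ M),
    Module.Finite Λ M ∧ IsIndecomposableModule Λ M ∧ grMeasure Λ M = I

/-- `J` is a direct successor of `I` (and `I` a direct predecessor of `J`):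
both are GR measures for `Λ`, `I ≺ J`, and no GR measure lies strictly
between them. -/
def IsDirectSuccessor (Λ : Type u) [Ring Λ] (I J : Set ℕ) : Prop :=
  IsGRMeasureOf Λ I ∧ IsGRMeasureOf Λ J ∧ GRlt I J ∧
    ¬ ∃ K, IsGRMeasureOf Λ K ∧ GRlt I K ∧ GRlt K J

/-- A GR segment: a nonempty set of GR measures closed under taking direct
successors and direct predecessors. -/
def IsGRSegment (Λ : Type u) [Ring Λ] (S : Set (Set ℕ)) : Prop :=
  S.Nonempty ∧ (∀ I ∈ S, IsGRMeasureOf Λ I) ∧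
    ∀ I ∈ S, ∀ J, (IsDirectSuccessor Λ I J ∨ IsDirectSuccessor Λ J I) → J ∈ S

theorem grlt_iff {I J : Set ℕ} :
    GRlt I J ↔ ∃ m ∈ J, m ∉ I ∧ ∀ k < m, (k ∈ I ↔ k ∈ J) := by
  constructor
  · rintro ⟨-, m, hm, hmin, hmJ⟩
    refine ⟨m, hmJ, fun hmI => ?_, fun k hk => ?_⟩
    · rcases hm with h | h
      · exact h.2 hmJ
      · exact h.2 hmI
    · by_contra hne
      have : k ∈ (I \ J) ∪ (J \ I) := by
        simp only [Set.mem_union, Set.mem_sdiff]; tauto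
      exact absurd (hmin k this) (by omega)
  · rintro ⟨m, hmJ, hmI, h⟩
    refine ⟨fun e => hmI (e ▸ hmJ), m, Or.inr ⟨hmJ, hmI⟩, fun k hk => ?_, hmJ⟩
    by_contra hlt
    have := h k (by omega)
    simp only [Set.mem_union, Set.mem_sdiff] at hk
    tauto

theorem GRlt.irrefl (I : Set ℕ) : ¬ GRlt I I := fun h => h.1 rfl

theorem GRlt.trans {I J K : Set ℕ} (h₁ : GRlt I J) (h₂ : GRlt J K) : GRlt I K := by
  rw [grlt_iff] at *
  obtain ⟨m, hmJ, hmI, hm⟩ := h₁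
  obtain ⟨n, hnK, hnJ, hn⟩ := h₂
  rcases lt_trichotomy m n with h | h | h
  · exact ⟨m, (hn m h).1 hmJ, hmI, fun k hk => (hm k hk).trans (hn k (hk.trans h))⟩
  · exact absurd hmJ (h ▸ hnJ)
  · exact ⟨n, hnK, fun hI => hnJ ((hm n h).1 hI),
      fun k hk => (hm k (hk.trans h)).trans (hn k hk)⟩

theorem grlt_trichotomy (I J : Set ℕ) : GRlt I J ∨ I = J ∨ GRlt J I := by
  classical
  by_cases h : I = J
  · exact Or.inr (Or.inl h)
  · have hex : ∃ m, ¬ (m ∈ I ↔ m ∈ J) := by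
      by_contra! hc
      exact h (Set.ext hc)
    have hlt : ∀ k < Nat.find hex, (k ∈ I ↔ k ∈ J) := fun k hk => by
      simpa using Nat.find_min hex hk
    have hm := Nat.find_spec hex
    by_cases hJ : Nat.find hex ∈ J
    · exact Or.inl (grlt_iff.2 ⟨_, hJ, by tauto, hlt⟩)
    · exact Or.inr (Or.inr (grlt_iff.2 ⟨_, by tauto, hJ, fun k hk => (hlt k hk).symm⟩))

theorem GRle.refl (I : Set ℕ) : GRle I I := Or.inl rfl

theorem GRlt.le {I J : Set ℕ} (h : GRlt I J) : GRle I J := Or.inr h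

theorem not_grlt {I J : Set ℕ} : ¬ GRlt I J ↔ GRle J I := by
  constructor
  · intro h
    rcases grlt_trichotomy I J with h' | h' | h'
    · exact absurd h' h
    · exact Or.inl h'.symm
    · exact Or.inr h'
  · rintro (rfl | h) h'
    · exact GRlt.irrefl _ h'
    · exact GRlt.irrefl _ (h.trans h')

theorem GRlt.trans_le {I J K : Set ℕ} (h₁ : GRlt I J) (h₂ : GRle J K) : GRlt I K := by
  rcases h₂ with rfl | h
  · exact h₁
  · exact h₁.trans h

theorem GRle.trans {I J K : Set ℕ} (h₁ : GRle I J) (h₂ : GRle J K) : GRle I K := by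
  rcases h₁ with rfl | h
  · exact h₂
  · exact (h.trans_le h₂).le

theorem GRle.antisymm {I J : Set ℕ} (h₁ : GRle I J) (h₂ : GRle J I) : I = J := by
  rcases h₁ with rfl | h
  · rfl
  · exact absurd (h.trans_le h₂) (GRlt.irrefl _)

theorem Set.Finite.exists_gr_max {T : Set (Set ℕ)} (hT : T.Finite) (hn : T.Nonempty) :
    ∃ s ∈ T, ∀ t ∈ T, GRle t s := by
  induction T, hT using Set.Finite.induction_on with
  | empty => exact absurd hn Set.not_nonempty_empty
  | @insert a T _ _ ih =>
    rcases T.eq_empty_or_nonempty with rfl | hne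
    · exact ⟨a, by simp, by simp [GRle.refl]⟩
    · obtain ⟨s, hs, hmax⟩ := ih hne
      rcases grlt_trichotomy a s with h | h | h
      · refine ⟨s, Or.inr hs, ?_⟩
        rintro t (rfl | ht)
        exacts [h.le, hmax t ht]
      · refine ⟨s, Or.inr hs, ?_⟩
        rintro t (rfl | ht)
        exacts [Or.inl h, hmax t ht]
      · refine ⟨a, Or.inl rfl, ?_⟩
        rintro t (rfl | ht)
        exacts [GRle.refl _, (hmax t ht).trans h.le]

theorem Set.Finite.exists_gr_min {T : Set (Set ℕ)} (hT : T.Finite) (hn : T.Nonempty) :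
    ∃ s ∈ T, ∀ t ∈ T, GRle s t := by
  induction T, hT using Set.Finite.induction_on with
  | empty => exact absurd hn Set.not_nonempty_empty
  | @insert a T _ _ ih =>
    rcases T.eq_empty_or_nonempty with rfl | hne
    · exact ⟨a, by simp, by simp [GRle.refl]⟩
    · obtain ⟨s, hs, hmin⟩ := ih hne
      rcases grlt_trichotomy s a with h | h | h
      · refine ⟨s, Or.inr hs, ?_⟩
        rintro t (rfl | ht)
        exacts [h.le, hmin t ht]
      · refine ⟨s, Or.inr hs, ?_⟩
        rintro t (rfl | ht)
        exacts [Or.inl h, hmin t ht]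
      · refine ⟨a, Or.inl rfl, ?_⟩
        rintro t (rfl | ht)
        exacts [GRle.refl _, h.le.trans (hmin t ht)]

section Length

variable {Λ : Type*} [Ring Λ] {M N : Type*} [AddCommGroup M] [Module Λ M]
  [AddCommGroup N] [Module Λ N]

theorem coe_mlen [IsArtinian Λ M] [IsNoetherian Λ M] :
    (mlen Λ M : ℕ∞) = Module.length Λ M := by
  have h : ∃ s : CompositionSeries (Submodule Λ M), s.head = ⊥ ∧ s.last = ⊤ :=
    exists_compositionSeries_of_isNoetherian_isArtinian Λ M
  rw [mlen, dif_pos h]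
  exact Module.length_compositionSeries _ h.choose_spec.1 h.choose_spec.2

theorem mlen_le_of_injective [IsArtinian Λ M] [IsNoetherian Λ M] (f : N →ₗ[Λ] M)
    (hf : Function.Injective f) : mlen Λ N ≤ mlen Λ M := by
  have := isArtinian_of_injective f hf
  have := isNoetherian_of_injective f hf
  have := Module.length_le_of_injective f hf
  rw [← coe_mlen, ← coe_mlen] at this
  exact_mod_cast this

theorem mlen_le_of_surjective [IsArtinian Λ M] [IsNoetherian Λ M] (f : M →ₗ[Λ] N)
    (hf : Function.Surjective f) : mlen Λ N ≤ mlen Λ M := by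
  have := isArtinian_of_surjective _ f hf
  have := isNoetherian_of_surjective f (LinearMap.range_eq_top.2 hf)
  have := Module.length_le_of_surjective f hf
  rw [← coe_mlen, ← coe_mlen] at this
  exact_mod_cast this

theorem LinearEquiv.mlen_eq [IsArtinian Λ M] [IsNoetherian Λ M] (e : M ≃ₗ[Λ] N) :
    mlen Λ M = mlen Λ N := by
  have := isArtinian_of_linearEquiv e
  have := isNoetherian_of_linearEquiv e
  exact le_antisymm (mlen_le_of_injective e.toLinearMap e.injective)
    (mlen_le_of_surjective e.toLinearMap e.surjective)

theorem mlen_ker_add_mlen_range [IsArtinian Λ M] [IsNoetherian Λ M] (f : M →ₗ[Λ] N) :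
    mlen Λ (LinearMap.ker f) + mlen Λ (LinearMap.range f) = mlen Λ M := by
  have := isArtinian_of_surjective _ f.rangeRestrict f.surjective_rangeRestrict
  have := isNoetherian_of_surjective f.rangeRestrict
    (LinearMap.range_eq_top.2 f.surjective_rangeRestrict)
  have h := Module.length_eq_add_of_exact (LinearMap.ker f).subtype f.rangeRestrict
    (Submodule.subtype_injective _) f.surjective_rangeRestrict (by
      rw [LinearMap.exact_iff]; simp)
  rw [← coe_mlen, ← coe_mlen, ← coe_mlen] at h
  exact_mod_cast h.symm

theorem mlen_pos [IsArtinian Λ M] [IsNoetherian Λ M] [Nontrivial M] : 0 < mlen Λ M := by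
  have := Module.length_pos (R := Λ) (M := M)
  rw [← coe_mlen] at this
  exact_mod_cast this

theorem mlen_eq_one [IsSimpleModule Λ M] : mlen Λ M = 1 := by
  have := Module.length_eq_one Λ M
  rw [← coe_mlen] at this
  exact_mod_cast this

theorem mlen_eq_zero [IsArtinian Λ M] [IsNoetherian Λ M] (h : mlen Λ M = 0) :
    Subsingleton M := by
  by_contra hn
  rw [not_subsingleton_iff_nontrivial] at hn
  exact absurd (mlen_pos (Λ := Λ) (M := M)) (by omega)

theorem Submodule.mlen_lt [IsArtinian Λ M] [IsNoetherian Λ M] {P : Submodule Λ M}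
    (h : P ≠ ⊤) : mlen Λ P < mlen Λ M := by
  have := Submodule.length_lt h
  rw [← coe_mlen, ← coe_mlen] at this
  exact_mod_cast this

theorem Submodule.mlen_mono [IsArtinian Λ M] [IsNoetherian Λ M] {P Q : Submodule Λ M}
    (h : P ≤ Q) : mlen Λ P ≤ mlen Λ Q :=
  mlen_le_of_injective (Submodule.inclusion h) (Submodule.inclusion_injective h)

theorem Submodule.eq_of_le_of_mlen_le [IsArtinian Λ M] [IsNoetherian Λ M] {P Q : Submodule Λ M}
    (h : P ≤ Q) (hl : mlen Λ Q ≤ mlen Λ P) : P = Q := by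
  refine le_antisymm h fun x hx => ?_
  by_contra hxP
  have hne : P.submoduleOf Q ≠ ⊤ := fun e => hxP <| by
    have : (⟨x, hx⟩ : Q) ∈ P.submoduleOf Q := e ▸ Submodule.mem_top
    exact this
  have h1 := Submodule.mlen_lt hne
  rw [(Submodule.submoduleOfEquivOfLe h).mlen_eq] at h1
  omega

theorem bijective_of_injective_of_mlen_le [IsArtinian Λ M] [IsNoetherian Λ M] (f : N →ₗ[Λ] M)
    (hf : Function.Injective f) (hl : mlen Λ M ≤ mlen Λ N) : Function.Bijective f := by
  refine ⟨hf, ?_⟩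
  by_contra hs
  have h1 := Submodule.mlen_lt (mt LinearMap.range_eq_top.1 hs)
  have := isArtinian_of_injective f hf
  have := isNoetherian_of_injective f hf
  rw [← (LinearEquiv.ofInjective f hf).mlen_eq] at h1
  omega

theorem mlen_lt_of_surjective [IsArtinian Λ M] [IsNoetherian Λ M] (f : M →ₗ[Λ] N)
    (hf : Function.Surjective f) (hi : ¬ Function.Bijective f) : mlen Λ N < mlen Λ M := by
  have h := mlen_ker_add_mlen_range f
  have hN : mlen Λ (LinearMap.range f) = mlen Λ N := by
    rw [LinearMap.range_eq_top.2 hf]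
    have := isArtinian_of_surjective _ f hf
    have := isNoetherian_of_surjective f (LinearMap.range_eq_top.2 hf)
    exact Submodule.topEquiv.mlen_eq
  have : Nontrivial (LinearMap.ker f) := by
    rw [Submodule.nontrivial_iff_ne_bot]
    exact fun hb => hi ⟨LinearMap.ker_eq_bot.1 hb, hf⟩
  have := mlen_pos (Λ := Λ) (M := LinearMap.ker f)
  omega

end Length

section Indecomposable

variable {Λ : Type*} [Ring Λ] {M N : Type*} [AddCommGroup M] [Module Λ M]
  [AddCommGroup N] [Module Λ N]

theorem IsIndecomposableModule.nontrivial (h : IsIndecomposableModule Λ M) : Nontrivial M := by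
  by_contra hn
  rw [not_nontrivial_iff_subsingleton] at hn
  exact h.1 (Subsingleton.elim _ _)

theorem IsIndecomposableModule.eq_bot_or_eq_top (h : IsIndecomposableModule Λ M)
    {A B : Submodule Λ M} (hAB : IsCompl A B) : (A = ⊥ ∧ B = ⊤) ∨ (A = ⊤ ∧ B = ⊥) := by
  by_cases hA : A = ⊥
  · subst hA
    exact Or.inl ⟨rfl, by simpa using hAB.sup_eq_top⟩
  · by_cases hB : B = ⊥
    · subst hB
      exact Or.inr ⟨by simpa using hAB.sup_eq_top, rfl⟩
    · exact absurd ⟨A, B, hA, hB, hAB⟩ h.2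

theorem IsIndecomposableModule.congr (h : IsIndecomposableModule Λ M) (e : M ≃ₗ[Λ] N) :
    IsIndecomposableModule Λ N := by
  have := h.nontrivial
  have : Nontrivial N := e.symm.toEquiv.nontrivial
  refine ⟨top_ne_bot, ?_⟩
  rintro ⟨A, B, hA, hB, hAB⟩
  let o := Submodule.orderIsoMapComap e.symm
  refine h.2 ⟨o A, o B, ?_, ?_, o.isCompl hAB⟩
  · simpa using hA
  · simpa using hB

theorem isIndecomposableModule_of_isSimpleModule [IsSimpleModule Λ M] :
    IsIndecomposableModule Λ M := by
  have := IsSimpleModule.nontrivial Λ M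
  refine ⟨top_ne_bot, ?_⟩
  rintro ⟨A, B, hA, hB, hAB⟩
  rcases eq_bot_or_eq_top A with h | h
  · exact hA h
  · rcases eq_bot_or_eq_top B with h' | h'
    · exact hB h'
    · subst h h'
      exact top_ne_bot (hAB.inf_eq_bot.symm ▸ (inf_idem _).symm)

/-- An injection into an indecomposable module with a section-like composite: if `f ≫ g` is
bijective and the middle module is indecomposable, then both maps are bijective. -/
theorem IsIndecomposableModule.bijective_of_comp {P : Type*} [AddCommGroup P] [Module Λ P]
    (h : IsIndecomposableModule Λ M) [Nontrivial N] (f : N →ₗ[Λ] M) (g : M →ₗ[Λ] P)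
    (hgf : Function.Bijective (g ∘ₗ f)) : Function.Bijective f ∧ Function.Bijective g := by
  have hfi : Function.Injective f := fun a b hab => hgf.1 (by simp [hab])
  have hgs : Function.Surjective g := fun p => by
    obtain ⟨n, rfl⟩ := hgf.2 p
    exact ⟨f n, rfl⟩
  have hc : IsCompl (LinearMap.range f) (LinearMap.ker g) := by
    constructor
    · rw [Submodule.disjoint_def]
      rintro _ ⟨n, rfl⟩ hn
      have : n = 0 := hgf.1 (by simpa using hn)
      simp [this]
    · rw [codisjoint_iff, eq_top_iff]
      rintro x -
      obtain ⟨n, hn⟩ := hgf.2 (g x)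
      rw [Submodule.mem_sup]
      refine ⟨f n, ⟨n, rfl⟩, x - f n, ?_, by abel⟩
      simp only [LinearMap.coe_comp, Function.comp_apply] at hn
      simp [hn]
  rcases h.eq_bot_or_eq_top hc with ⟨h1, -⟩ | ⟨h1, h2⟩
  · obtain ⟨n, hn⟩ := exists_ne (0 : N)
    have : f n = 0 := by
      have : f n ∈ LinearMap.range f := ⟨n, rfl⟩
      rwa [h1, Submodule.mem_bot] at this
    exact absurd (hfi (this.trans (map_zero f).symm)) hn
  · exact ⟨⟨hfi, LinearMap.range_eq_top.1 h1⟩, ⟨LinearMap.ker_eq_bot.1 h2, hgs⟩⟩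

/-- A finite length module is a finite direct sum of indecomposable submodules, expressed
through the projections. -/
theorem exists_indecomposable_decomposition [IsArtinian Λ M] [IsNoetherian Λ M] :
    ∃ (k : ℕ) (P : Fin k → Submodule Λ M) (p : ∀ j, M →ₗ[Λ] P j),
      (∀ j, IsIndecomposableModule Λ (P j)) ∧ (∀ j, Function.Surjective (p j)) ∧
      ∀ x : M, ∑ j, (p j x : M) = x := by
  suffices H : ∀ (n : ℕ) (A : Submodule Λ M) (q : M →ₗ[Λ] A), Function.Surjective q →
      mlen Λ A ≤ n → ∃ (k : ℕ) (P : Fin k → Submodule Λ M) (p : ∀ j, M →ₗ[Λ] P j),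
      (∀ j, IsIndecomposableModule Λ (P j)) ∧ (∀ j, Function.Surjective (p j)) ∧
      ∀ x : M, ∑ j, (p j x : M) = q x by
    simpa using H _ ⊤ Submodule.topEquiv.symm.toLinearMap Submodule.topEquiv.symm.surjective le_rfl
  intro n
  induction n with
  | zero =>
    intro A q _ hA
    have := mlen_eq_zero (Nat.le_zero.1 hA)
    refine ⟨0, Fin.elim0, fun j => j.elim0, fun j => j.elim0, fun j => j.elim0, fun x => ?_⟩
    simp [Subsingleton.elim (q x) 0]
  | succ n ih =>
    intro A q hq hA
    by_cases hind : IsIndecomposableModule Λ A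
    · exact ⟨1, fun _ => A, fun _ => q, fun _ => hind, fun _ => hq, fun x => by simp⟩
    by_cases hbot : (⊤ : Submodule Λ A) = ⊥
    · have : Subsingleton A := by
        by_contra hn
        rw [not_subsingleton_iff_nontrivial] at hn
        exact top_ne_bot hbot
      refine ⟨0, Fin.elim0, fun j => j.elim0, fun j => j.elim0, fun j => j.elim0, fun x => ?_⟩
      simp [Subsingleton.elim (q x) 0]
    obtain ⟨U, V, hU, hV, hUV⟩ : ∃ U V : Submodule Λ A, U ≠ ⊥ ∧ V ≠ ⊥ ∧ IsCompl U V := by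
      by_contra hc
      exact hind ⟨hbot, hc⟩
    have key : ∀ {U V : Submodule Λ A}, U ≠ ⊥ → V ≠ ⊥ → IsCompl U V → mlen Λ U ≤ n := by
      intro U V _ hV hUV
      have : U ≠ ⊤ := by
        rintro rfl
        exact hV (by simpa using hUV.inf_eq_bot)
      have := Submodule.mlen_lt this
      omega
    have step : ∀ {U V : Submodule Λ A} (hUV : IsCompl U V), mlen Λ U ≤ n →
        ∃ (k : ℕ) (P : Fin k → Submodule Λ M) (p : ∀ j, M →ₗ[Λ] P j),
        (∀ j, IsIndecomposableModule Λ (P j)) ∧ (∀ j, Function.Surjective (p j)) ∧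
        ∀ x : M, ∑ j, (p j x : M) = (U.projectionOnto V hUV (q x) : A) := by
      intro U V hUV hl
      let e : U ≃ₗ[Λ] U.map A.subtype := Submodule.equivSubtypeMap A U
      obtain ⟨k, P, p, h1, h2, h3⟩ := ih (U.map A.subtype)
        (e.toLinearMap ∘ₗ U.projectionOnto V hUV ∘ₗ q)
        (e.surjective.comp ((Submodule.projectionOnto_surjective hUV).comp hq))
        (by rwa [← e.mlen_eq])
      exact ⟨k, P, p, h1, h2, fun x => by rw [h3]; rfl⟩
    obtain ⟨k, P, p, h1, h2, h3⟩ := step hUV (key hU hV hUV)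
    obtain ⟨k', P', p', h1', h2', h3'⟩ := step hUV.symm (key hV hU hUV.symm)
    let PP : Fin k ⊕ Fin k' → Submodule Λ M := Sum.elim P P'
    let pp : ∀ j, M →ₗ[Λ] PP j := fun j => match j with
      | Sum.inl j => p j
      | Sum.inr j => p' j
    refine ⟨k + k', fun j => PP (finSumFinEquiv.symm j), fun j => pp (finSumFinEquiv.symm j),
      fun j => ?_, fun j => ?_, fun x => ?_⟩
    · change IsIndecomposableModule Λ (PP (finSumFinEquiv.symm j))
      rcases finSumFinEquiv.symm j with j | j
      exacts [h1 j, h1' j]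
    · change Function.Surjective (pp (finSumFinEquiv.symm j))
      rcases finSumFinEquiv.symm j with j | j
      exacts [h2 j, h2' j]
    · rw [Equiv.sum_comp finSumFinEquiv.symm (fun j => (pp j x : M)), Fintype.sum_sum_type]
      change ∑ j, (p j x : M) + ∑ j, (p' j x : M) = _
      rw [h3, h3', ← Submodule.coe_add, Submodule.coe_projectionOnto_apply,
        Submodule.coe_projectionOnto_apply, Submodule.projection_add_projection_eq_self]

end Indecomposable

section GRMeasure

variable {Λ : Type*} [Ring Λ] {M N : Type*} [AddCommGroup M] [Module Λ M]
  [AddCommGroup N] [Module Λ N]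

/-- A finite nonempty chain of indecomposable submodules, as a set of submodules. -/
structure IsGRChain (C : Set (Submodule Λ M)) : Prop where
  finite : C.Finite
  nonempty : C.Nonempty
  chain : IsChain (· ≤ ·) C
  indec : ∀ c ∈ C, IsIndecomposableModule Λ c

/-- The set of lengths of a set of submodules. -/
def lengthSet (C : Set (Submodule Λ M)) : Set ℕ := (fun c : Submodule Λ M => mlen Λ c) '' C

theorem mem_grChainSets_iff [IsArtinian Λ M] [IsNoetherian Λ M] {S : Set ℕ} :
    S ∈ grChainSets Λ M ↔ ∃ C : Set (Submodule Λ M), IsGRChain C ∧ S = lengthSet C := by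
  constructor
  · rintro ⟨t, c, hc, hi, rfl⟩
    refine ⟨Set.range c, ⟨Set.finite_range c, Set.range_nonempty c, ?_, ?_⟩, ?_⟩
    · rintro _ ⟨i, rfl⟩ _ ⟨j, rfl⟩ -
      rcases le_total i j with h | h
      · exact Or.inl (hc.monotone h)
      · exact Or.inr (hc.monotone h)
    · rintro _ ⟨i, rfl⟩
      exact hi i
    · exact Set.range_comp (fun c : Submodule Λ M => mlen Λ c) c
  · rintro ⟨C, hC, rfl⟩
    have hfin : (lengthSet C).Finite := hC.finite.image _
    set F := hfin.toFinset with hF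
    have hmem : ∀ n, n ∈ F ↔ n ∈ lengthSet C := fun n => by simp [hF]
    have hFn : F.Nonempty := by
      obtain ⟨c, hc⟩ := hC.nonempty
      exact ⟨_, (hmem _).2 ⟨c, hc, rfl⟩⟩
    obtain ⟨t, ht⟩ : ∃ t, F.card = t + 1 := ⟨F.card - 1, by have := hFn.card_pos; omega⟩
    let e := F.orderEmbOfFin ht
    have hex : ∀ i, ∃ c ∈ C, mlen Λ c = e i := fun i =>
      (hmem _).1 (F.orderEmbOfFin_mem ht i)
    choose c hcC hce using hex
    refine ⟨t, c, fun i j hij => ?_, fun i => hC.indec _ (hcC i), ?_⟩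
    · have hlt : mlen Λ (c i) < mlen Λ (c j) := by
        rw [hce, hce]
        exact e.strictMono hij
      rcases hC.chain.total (hcC i) (hcC j) with h | h
      · exact lt_of_le_of_ne h fun he => by rw [he] at hlt; exact lt_irrefl _ hlt
      · have := Submodule.mlen_mono h
        omega
    · simp_rw [hce]
      have := F.range_orderEmbOfFin ht
      change lengthSet C = Set.range e
      rw [this]
      ext n
      simp [hF]

theorem lengthSet_subset [IsArtinian Λ M] [IsNoetherian Λ M] (C : Set (Submodule Λ M)) :
    lengthSet C ⊆ Set.Iic (mlen Λ M) := by
  rintro _ ⟨c, -, rfl⟩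
  exact mlen_le_of_injective c.subtype c.subtype_injective

theorem exists_indecomposable_submodule_mlen_one [IsArtinian Λ M] [IsNoetherian Λ M]
    [Nontrivial M] : ∃ S : Submodule Λ M, IsIndecomposableModule Λ S ∧ mlen Λ S = 1 := by
  obtain ⟨S, hS, -⟩ := (eq_bot_or_exists_atom_le (⊤ : Submodule Λ M)).resolve_left top_ne_bot
  have : IsSimpleModule Λ S := isSimpleModule_iff_isAtom.2 hS
  exact ⟨S, isIndecomposableModule_of_isSimpleModule, mlen_eq_one⟩

theorem isGRChain_singleton {S : Submodule Λ M} (hS : IsIndecomposableModule Λ S) :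
    IsGRChain {S} :=
  ⟨Set.finite_singleton _, Set.singleton_nonempty _, IsChain.singleton, by simpa using hS⟩

theorem grMeasure_spec [IsArtinian Λ M] [IsNoetherian Λ M] [Nontrivial M] :
    (∃ C : Set (Submodule Λ M), IsGRChain C ∧ grMeasure Λ M = lengthSet C) ∧
      ∀ C : Set (Submodule Λ M), IsGRChain C → GRle (lengthSet C) (grMeasure Λ M) := by
  have hfin : (grChainSets Λ M).Finite :=
    ((Set.finite_Iic (mlen Λ M)).finite_subsets).subset fun S hS => by
      obtain ⟨C, -, rfl⟩ := mem_grChainSets_iff.1 hS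
      exact lengthSet_subset C
  have hne : (grChainSets Λ M).Nonempty := by
    obtain ⟨S, hS, -⟩ := exists_indecomposable_submodule_mlen_one (Λ := Λ) (M := M)
    exact ⟨_, mem_grChainSets_iff.2 ⟨_, isGRChain_singleton hS, rfl⟩⟩
  have h := hfin.exists_gr_max hne
  rw [grMeasure, dif_pos h]
  exact ⟨mem_grChainSets_iff.1 h.choose_spec.1,
    fun C hC => h.choose_spec.2 _ (mem_grChainSets_iff.2 ⟨C, hC, rfl⟩)⟩

theorem IsGRChain.map [IsArtinian Λ M] [IsNoetherian Λ M] {C : Set (Submodule Λ M)}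
    (hC : IsGRChain C) (f : M →ₗ[Λ] N) (hf : Function.Injective f) :
    IsGRChain (Submodule.map f '' C) ∧ lengthSet (Submodule.map f '' C) = lengthSet C := by
  refine ⟨⟨hC.finite.image _, hC.nonempty.image _, ?_, ?_⟩, ?_⟩
  · rintro _ ⟨a, ha, rfl⟩ _ ⟨b, hb, rfl⟩ -
    rcases hC.chain.total ha hb with h | h
    · exact Or.inl (Submodule.map_mono h)
    · exact Or.inr (Submodule.map_mono h)
  · rintro _ ⟨a, ha, rfl⟩
    exact (hC.indec a ha).congr (Submodule.equivMapOfInjective f hf a)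
  · rw [lengthSet, Set.image_image]
    refine Set.image_congr fun a _ => ?_
    exact (Submodule.equivMapOfInjective f hf a).mlen_eq.symm

theorem grMeasure_le_of_injective [IsArtinian Λ M] [IsNoetherian Λ M] [Nontrivial N]
    (f : N →ₗ[Λ] M) (hf : Function.Injective f) : GRle (grMeasure Λ N) (grMeasure Λ M) := by
  have := isArtinian_of_injective f hf
  have := isNoetherian_of_injective f hf
  have := hf.nontrivial
  obtain ⟨C, hC, h⟩ := (grMeasure_spec (Λ := Λ) (M := N)).1
  rw [h, ← (hC.map f hf).2]
  exact grMeasure_spec.2 _ (hC.map f hf).1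

theorem LinearEquiv.grMeasure_eq [IsArtinian Λ M] [IsNoetherian Λ M] [Nontrivial M]
    (e : M ≃ₗ[Λ] N) : grMeasure Λ M = grMeasure Λ N := by
  have := isArtinian_of_linearEquiv e
  have := isNoetherian_of_linearEquiv e
  have : Nontrivial N := e.symm.toEquiv.nontrivial
  exact (grMeasure_le_of_injective e.toLinearMap e.injective).antisymm
    (grMeasure_le_of_injective e.symm.toLinearMap e.symm.injective)

theorem grMeasure_subset [IsArtinian Λ M] [IsNoetherian Λ M] [Nontrivial M] :
    grMeasure Λ M ⊆ Set.Icc 1 (mlen Λ M) := by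
  obtain ⟨C, hC, h⟩ := (grMeasure_spec (Λ := Λ) (M := M)).1
  rw [h]
  rintro n hn
  refine ⟨?_, lengthSet_subset C hn⟩
  obtain ⟨c, hc, rfl⟩ := hn
  have := (hC.indec c hc).nontrivial
  exact mlen_pos

theorem one_mem_grMeasure [IsArtinian Λ M] [IsNoetherian Λ M] [Nontrivial M] :
    1 ∈ grMeasure Λ M := by
  obtain ⟨S, hS, h1⟩ := exists_indecomposable_submodule_mlen_one (Λ := Λ) (M := M)
  have h := grMeasure_spec.2 _ (isGRChain_singleton hS)
  have hl : lengthSet {S} = {1} := by simp [lengthSet, h1]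
  rw [hl] at h
  rcases h with h | h
  · rw [← h]; rfl
  · obtain ⟨m, hm, hm1, hk⟩ := grlt_iff.1 h
    have h2 := (grMeasure_subset hm).1
    have h3 : m ≠ 1 := hm1
    exact (hk 1 (by omega)).1 rfl

/-- Adding the whole (indecomposable) module to a chain. -/
theorem IsGRChain.insert_top {C : Set (Submodule Λ M)} (hC : IsGRChain C)
    (h : IsIndecomposableModule Λ M) : IsGRChain (insert ⊤ C) := by
  refine ⟨hC.finite.insert _, Set.insert_nonempty _ _,
    hC.chain.insert fun b _ _ => Or.inr le_top, ?_⟩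
  rintro c (rfl | hc)
  · exact h.congr Submodule.topEquiv.symm
  · exact hC.indec c hc

theorem lengthSet_insert_top [IsArtinian Λ M] [IsNoetherian Λ M] (C : Set (Submodule Λ M)) :
    lengthSet (insert ⊤ C) = insert (mlen Λ M) (lengthSet C) := by
  rw [lengthSet, Set.image_insert_eq, Submodule.topEquiv.mlen_eq]
  rfl

theorem grlt_insert {I : Set ℕ} {n : ℕ} (hn : n ∉ I) : GRlt I (insert n I) :=
  grlt_iff.2 ⟨n, Or.inl rfl, hn, fun k hk => by
    simp [show k ≠ n by omega]⟩

theorem mlen_mem_grMeasure [IsArtinian Λ M] [IsNoetherian Λ M]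
    (h : IsIndecomposableModule Λ M) : mlen Λ M ∈ grMeasure Λ M := by
  have := h.nontrivial
  obtain ⟨C, hC, hCM⟩ := (grMeasure_spec (Λ := Λ) (M := M)).1
  by_contra hn
  have h1 := grMeasure_spec.2 _ (hC.insert_top h)
  rw [lengthSet_insert_top, ← hCM] at h1
  exact GRlt.irrefl _ ((grlt_insert hn).trans_le h1)

theorem grMeasure_lt_of_injective [IsArtinian Λ M] [IsNoetherian Λ M] [Nontrivial N]
    (h : IsIndecomposableModule Λ M) (f : N →ₗ[Λ] M) (hf : Function.Injective f)
    (hs : ¬ Function.Bijective f) : GRlt (grMeasure Λ N) (grMeasure Λ M) := by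
  have hl : mlen Λ N < mlen Λ M := by
    by_contra hl
    exact hs (bijective_of_injective_of_mlen_le f hf (by omega))
  have := isArtinian_of_injective f hf
  have := isNoetherian_of_injective f hf
  have := h.nontrivial
  rcases grMeasure_le_of_injective f hf with he | h'
  · have h1 := mlen_mem_grMeasure h
    rw [← he] at h1
    exact absurd (grMeasure_subset h1).2 (by simpa using hl)
  · exact h'

/-- Initial segments of Gabriel–Roiter measures are realised by submodules. -/
theorem exists_submodule_grMeasure_eq [IsArtinian Λ M] [IsNoetherian Λ M] [Nontrivial M]
    {n : ℕ} (hn : n ∈ grMeasure Λ M) :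
    ∃ Z : Submodule Λ M, IsIndecomposableModule Λ Z ∧ mlen Λ Z = n ∧
      grMeasure Λ Z = grMeasure Λ M ∩ Set.Iic n := by
  obtain ⟨C, hC, hCM⟩ := (grMeasure_spec (Λ := Λ) (M := M)).1
  rw [hCM] at hn
  obtain ⟨Z, hZC, rfl⟩ := hn
  have hZ := hC.indec Z hZC
  refine ⟨Z, hZ, rfl, ?_⟩
  have := hZ.nontrivial
  obtain ⟨D, hD, hDZ⟩ := (grMeasure_spec (Λ := Λ) (M := Z)).1
  -- the part of `C` below `Z`, as a chain of submodules of `Z`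
  have hlow : GRle (lengthSet C ∩ Set.Iic (mlen Λ Z)) (grMeasure Λ Z) := by
    let C' : Set (Submodule Λ Z) := {c | c.map Z.subtype ∈ C}
    have hinj : Function.Injective (Submodule.map Z.subtype) :=
      Submodule.map_injective_of_injective Z.subtype_injective
    have hC' : IsGRChain C' := by
      refine ⟨hC.finite.preimage hinj.injOn, ⟨⊤, ?_⟩, ?_, ?_⟩
      · change (⊤ : Submodule Λ Z).map Z.subtype ∈ C
        simpa using hZC
      · intro a ha b hb _
        rcases hC.chain.total ha hb with h | h
        · exact Or.inl ((Submodule.map_le_map_iff_of_injective Z.subtype_injective _ _).1 h)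
        · exact Or.inr ((Submodule.map_le_map_iff_of_injective Z.subtype_injective _ _).1 h)
      · intro c hc
        exact (hC.indec _ hc).congr
          (Submodule.equivMapOfInjective Z.subtype Z.subtype_injective c).symm
    have he : lengthSet C' = lengthSet C ∩ Set.Iic (mlen Λ Z) := by
      ext k
      constructor
      · rintro ⟨c, hc, rfl⟩
        refine ⟨⟨_, hc, ?_⟩, mlen_le_of_injective c.subtype c.subtype_injective⟩
        exact (Submodule.equivMapOfInjective Z.subtype Z.subtype_injective c).mlen_eq.symm
      · rintro ⟨⟨c, hc, rfl⟩, hk⟩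
        have hcZ : c ≤ Z := by
          rcases hC.chain.total hc hZC with h | h
          · exact h
          · exact (Submodule.eq_of_le_of_mlen_le h hk).ge
        refine ⟨c.submoduleOf Z, ?_, (Submodule.submoduleOfEquivOfLe hcZ).mlen_eq⟩
        change (c.submoduleOf Z).map Z.subtype ∈ C
        rwa [Submodule.submoduleOf, Submodule.map_comap_subtype, inf_eq_right.2 hcZ]
    rw [← he]
    exact grMeasure_spec.2 _ hC'
  rw [hCM]
  refine (hlow.antisymm ?_).symm
  -- otherwise a better chain in `Z` can be extended by the part of `C` above `Z`
  rw [← not_grlt]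
  intro hlt
  have hmap := hD.map Z.subtype Z.subtype_injective
  have hle : ∀ d ∈ Submodule.map Z.subtype '' D, d ≤ Z := by
    rintro _ ⟨d, -, rfl⟩
    exact Submodule.map_subtype_le Z d
  let C'' : Set (Submodule Λ M) := Submodule.map Z.subtype '' D ∪ {c ∈ C | Z ≤ c}
  have hC'' : IsGRChain C'' := by
    refine ⟨hmap.1.finite.union (hC.finite.subset fun _ h => h.1),
      hmap.1.nonempty.mono Set.subset_union_left, ?_, ?_⟩
    · rintro a (ha | ha) b (hb | hb) hab
      · exact hmap.1.chain ha hb hab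
      · exact Or.inl ((hle a ha).trans hb.2)
      · exact Or.inr ((hle b hb).trans ha.2)
      · exact hC.chain ha.1 hb.1 hab
    · rintro c (hc | hc)
      exacts [hmap.1.indec c hc, hC.indec c hc.1]
  have h1 := grMeasure_spec.2 _ hC''
  rw [hCM] at h1
  refine GRlt.irrefl _ (GRlt.trans_le ?_ h1)
  obtain ⟨m, hm, hmI, hk⟩ := grlt_iff.1 hlt
  have hmZ := (grMeasure_subset hm).2
  have hl : lengthSet C'' = grMeasure Λ Z ∪ lengthSet {c ∈ C | Z ≤ c} := by
    rw [hDZ, ← hmap.2]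
    exact Set.image_union _ _ _
  rw [grlt_iff, hl]
  refine ⟨m, Or.inl hm, fun h => hmI ⟨h, hmZ⟩, fun k hkm => ?_⟩
  have hk' := hk k hkm
  constructor
  · intro h
    exact Or.inl (hk'.1 ⟨h, hkm.le.trans hmZ⟩)
  · rintro (h | ⟨c, hc, rfl⟩)
    · exact (hk'.2 h).1
    · exact ⟨c, hc.1, rfl⟩

/-- Gabriel's main property of the Gabriel–Roiter measure. -/
theorem exists_grMeasure_lt_or_bijective {ι : Type*} [Finite ι] {Z : Type*} [AddCommGroup Z]
    [Module Λ Z] [IsArtinian Λ Z] [IsNoetherian Λ Z] (hZ : IsIndecomposableModule Λ Z)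
    {Y : ι → Type*} [∀ i, AddCommGroup (Y i)] [∀ i, Module Λ (Y i)] [∀ i, IsArtinian Λ (Y i)]
    [∀ i, IsNoetherian Λ (Y i)] (hY : ∀ i, IsIndecomposableModule Λ (Y i))
    (f : ∀ i, Z →ₗ[Λ] Y i) (hf : ∀ z, (∀ i, f i z = 0) → z = 0) :
    ∃ i, GRlt (grMeasure Λ Z) (grMeasure Λ (Y i)) ∨ Function.Bijective (f i) := by
  induction hn : mlen Λ Z using Nat.strong_induction_on generalizing ι Z Y with
  | _ n ih =>
  subst hn
  have hZn := hZ.nontrivial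
  -- the case of a family of epimorphisms
  have epi : ∀ {κ : Type _} [Finite κ] {N : κ → Type _} [∀ i, AddCommGroup (N i)]
      [∀ i, Module Λ (N i)] [∀ i, IsArtinian Λ (N i)] [∀ i, IsNoetherian Λ (N i)]
      (_ : ∀ i, IsIndecomposableModule Λ (N i)) (g : ∀ i, Z →ₗ[Λ] N i)
      (_ : ∀ z, (∀ i, g i z = 0) → z = 0) (_ : ∀ i, Function.Surjective (g i)),
      ∃ i, GRlt (grMeasure Λ Z) (grMeasure Λ (N i)) ∨ Function.Bijective (g i) := by
    intro κ _ N _ _ _ _ hN g hg hgs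
    by_contra! hcon
    have hlen : ∀ i, mlen Λ (N i) < mlen Λ Z := fun i =>
      mlen_lt_of_surjective (g i) (hgs i) (hcon i).2
    have hκ : Nonempty κ := by
      by_contra hκ
      rw [not_nonempty_iff] at hκ
      obtain ⟨z, hz⟩ := exists_ne (0 : Z)
      exact hz (hg z fun i => hκ.elim i)
    have hne : (grMeasure Λ Z \ {mlen Λ Z}).Nonempty := by
      refine ⟨1, one_mem_grMeasure, ?_⟩
      obtain ⟨i⟩ := hκ
      have := (hN i).nontrivial
      have h1 := mlen_pos (Λ := Λ) (M := N i)
      have h2 := hlen i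
      intro h
      rw [Set.mem_singleton_iff] at h
      omega
    have hfin : (grMeasure Λ Z \ {mlen Λ Z}).Finite :=
      (Set.finite_Icc 1 (mlen Λ Z)).subset (Set.sdiff_subset.trans grMeasure_subset)
    obtain ⟨m, hm, hmax⟩ := hfin.exists_maximal hne
    have hmlt : m < mlen Λ Z := lt_of_le_of_ne (grMeasure_subset hm.1).2 hm.2
    obtain ⟨Z', hZ', hl, hμ⟩ := exists_submodule_grMeasure_eq hm.1
    obtain ⟨i, h | h⟩ := ih _ (hl.trans_lt hmlt) hZ' hN (fun i => g i ∘ₗ Z'.subtype)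
      (fun z hz => Subtype.ext (hg z hz)) rfl
    · refine (hcon i).1 ?_
      have := (hN i).nontrivial
      obtain ⟨k, hk, hkZ, hkl⟩ := grlt_iff.1 h
      have hki := (grMeasure_subset hk).2
      have hlt := hlen i
      have key : ∀ l < mlen Λ Z, (l ∈ grMeasure Λ Z' ↔ l ∈ grMeasure Λ Z) := by
        intro l hlt
        rw [hμ]
        refine ⟨fun h => h.1, fun h => ⟨h, ?_⟩⟩
        by_contra hlm
        exact hlm (hmax ⟨h, fun e => hlt.ne e⟩ (not_le.1 hlm).le)
      exact grlt_iff.2 ⟨k, hk, fun h => hkZ ((key k (by omega)).2 h),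
        fun l hlk => (key l (by omega)).symm.trans (hkl l hlk)⟩
    · have := hZ'.nontrivial
      exact (hcon i).2 (hZ.bijective_of_comp _ _ h).2
  have hA : ∀ i, IsArtinian Λ (LinearMap.range (f i)) := fun i => inferInstance
  choose k P p hP hps hpx using fun i =>
    exists_indecomposable_decomposition (Λ := Λ) (M := LinearMap.range (f i))
  obtain ⟨⟨i, j⟩, h⟩ := epi (κ := Σ i, Fin (k i)) (N := fun q => P q.1 q.2)
    (fun q => hP q.1 q.2) (fun q => p q.1 q.2 ∘ₗ (f q.1).rangeRestrict)
    (fun z hz => hf z fun i => by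
      have h := hpx i ((f i).rangeRestrict z)
      have h0 : ∀ j, p i j ((f i).rangeRestrict z) = 0 := fun j => hz ⟨i, j⟩
      simp only [h0, ZeroMemClass.coe_zero, Finset.sum_const_zero] at h
      exact congrArg Subtype.val h.symm)
    (fun q => (hps q.1 q.2).comp (f q.1).surjective_rangeRestrict)
  refine ⟨i, ?_⟩
  have := (hP i j).nontrivial
  rcases h with h | h
  · exact Or.inl (h.trans_le (grMeasure_le_of_injective
      ((LinearMap.range (f i)).subtype ∘ₗ (P i j).subtype)
      ((LinearMap.range (f i)).subtype_injective.comp (P i j).subtype_injective)))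
  · have hinj : Function.Injective (f i) := fun a b hab => h.1 (by
      simp only [LinearMap.comp_apply]
      congr 1
      exact Subtype.ext hab)
    by_cases hb : Function.Bijective (f i)
    · exact Or.inr hb
    · exact Or.inl (grMeasure_lt_of_injective (hY i) (f i) hinj hb)

end GRMeasure

section Duality

/-- `E` is a dualizing module for `R`: an injective cogenerator such that `R`-duals are no longer
than the modules themselves. -/
structure IsDualizing (R : Type u) [CommRing R] (E : Type u) [AddCommGroup E] [Module R E] :
    Prop where
  extend : ∀ {A B : Type u} [AddCommGroup A] [AddCommGroup B] [Module R A] [Module R B]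
    (i : A →ₗ[R] B) (_ : Function.Injective i) (φ : A →ₗ[R] E), ∃ ψ : B →ₗ[R] E, ψ ∘ₗ i = φ
  exists_ne_zero : ∀ {M : Type u} [AddCommGroup M] [Module R M] {x : M} (_ : x ≠ 0),
    ∃ φ : M →ₗ[R] E, φ x ≠ 0
  length_le : ∀ {M : Type u} [AddCommGroup M] [Module R M] (_ : IsFiniteLength R M),
    Module.length R (M →ₗ[R] E) ≤ Module.length R M

variable {R : Type u} [CommRing R]

theorem exists_injective_embedding (R : Type u) [CommRing R] (T : Type u) [AddCommGroup T]
    [Module R T] :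
    ∃ (I : Type u) (_ : AddCommGroup I) (_ : Module R I) (j : T →ₗ[R] I),
      Module.Injective R I ∧ Function.Injective j := by
  let X := ModuleCat.of R T
  let I : ModuleCat.{u} R := CategoryTheory.Injective.under X
  have : CategoryTheory.Injective (ModuleCat.of R I) :=
    inferInstanceAs (CategoryTheory.Injective (CategoryTheory.Injective.under X))
  exact ⟨I, inferInstance, inferInstance, (CategoryTheory.Injective.ι X).hom,
    Module.injective_module_of_injective_object R I,
    (ModuleCat.mono_iff_injective _).1 inferInstance⟩

/-- Every submodule `T` of an injective module `I` is contained in a direct summand of `I` in which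
it is essential. -/
theorem exists_essential_summand {I : Type u} [AddCommGroup I] [Module R I]
    (hI : Module.Injective R I) (T : Submodule R I) :
    ∃ (E : Submodule R I) (p : I →ₗ[R] E), T ≤ E ∧ (∀ x : E, p x = x) ∧
      ∀ x ∈ E, x ≠ 0 → ∃ r : R, r • x ∈ T ∧ r • x ≠ 0 := by
  let 𝓔 : Set (Submodule R I) :=
    {F | T ≤ F ∧ ∀ x ∈ F, x ≠ 0 → ∃ r : R, r • x ∈ T ∧ r • x ≠ 0}
  obtain ⟨E, hTE, hE⟩ := zorn_le_nonempty₀ 𝓔 (fun c hc hchain y hy => by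
    refine ⟨sSup c, ⟨(hc hy).1.trans (le_sSup hy), fun x hx hx0 => ?_⟩, fun z hz => le_sSup hz⟩
    obtain ⟨F, hF, hxF⟩ := (Submodule.mem_sSup_of_directed ⟨y, hy⟩ hchain.directedOn).1 hx
    exact (hc hF).2 x hxF hx0) T
      ⟨le_rfl, fun x hx hx0 => ⟨1, by simpa using hx, by simpa using hx0⟩⟩
  obtain ⟨K, -, hK⟩ := zorn_le_nonempty₀ {K : Submodule R I | ∀ x ∈ K, x ∈ E → x = 0}
    (fun c hc hchain y hy => by
      refine ⟨sSup c, fun x hx hxE => ?_, fun z hz => le_sSup hz⟩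
      obtain ⟨F, hF, hxF⟩ := (Submodule.mem_sSup_of_directed ⟨y, hy⟩ hchain.directedOn).1 hx
      exact hc hF x hxF hxE) ⊥ (fun x hx _ => by simpa using hx)
  have hKE : ∀ x ∈ K, x ∈ E → x = 0 := hK.prop
  -- `E → I ⧸ K` extends the inclusion of `E`
  have hinj : Function.Injective (K.mkQ ∘ₗ E.subtype) := by
    rw [injective_iff_map_eq_zero]
    intro x hx
    exact Subtype.ext (hKE x ((Submodule.Quotient.mk_eq_zero K).1 hx) x.2)
  obtain ⟨h, hh⟩ := Module.Injective.out (K.mkQ ∘ₗ E.subtype) hinj E.subtype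
  have key : ∀ w : I ⧸ K, w ≠ 0 → ∃ r : R, r • h w ∈ T ∧ r • h w ≠ 0 := by
    intro w hw
    obtain ⟨x, rfl⟩ := K.mkQ_surjective w
    have hxK : x ∉ K := fun hx => hw ((Submodule.Quotient.mk_eq_zero K).2 hx)
    have hnot : ¬ ∀ z ∈ K ⊔ R ∙ x, z ∈ E → z = 0 := fun hz =>
      hxK (hK.2 (y := K ⊔ R ∙ x) hz le_sup_left
        ((le_sup_right : _ ≤ K ⊔ R ∙ x) (Submodule.mem_span_singleton_self x)))
    push Not at hnot
    obtain ⟨z, hz, hzE, hz0⟩ := hnot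
    obtain ⟨k, hk, y, hy, rfl⟩ := Submodule.mem_sup.1 hz
    obtain ⟨r, rfl⟩ := Submodule.mem_span_singleton.1 hy
    have he : h (r • K.mkQ x) = k + r • x := by
      have := hh ⟨k + r • x, hzE⟩
      rw [LinearMap.comp_apply, Submodule.subtype_apply, map_add, map_smul] at this
      rwa [show K.mkQ k = 0 from (Submodule.Quotient.mk_eq_zero K).2 hk, zero_add] at this
    obtain ⟨s, hs, hs0⟩ := hE.prop.2 _ hzE hz0
    refine ⟨s * r, ?_⟩
    rw [mul_smul, ← map_smul, he]
    exact ⟨hs, hs0⟩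
  have hle : E ≤ LinearMap.range h := fun x hx => ⟨K.mkQ x, hh ⟨x, hx⟩⟩
  have hrange : LinearMap.range h ≤ E := by
    refine hE.2 ⟨hTE.trans hle, ?_⟩ hle
    rintro _ ⟨w, rfl⟩ hw
    exact key w fun hw0 => hw (by rw [hw0, map_zero])
  refine ⟨E, (h ∘ₗ K.mkQ).codRestrict E fun x => hrange ⟨_, rfl⟩, hTE, fun x => ?_, hE.prop.2⟩
  exact Subtype.ext (hh x)

theorem length_linearMap_le_of_simple {E : Type u} [AddCommGroup E] [Module R E]
    (h : ∀ S : Type u, ∀ [AddCommGroup S] [Module R S] [IsSimpleModule R S],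
      Module.length R (S →ₗ[R] E) ≤ 1) {M : Type u} [AddCommGroup M] [Module R M]
    (hM : IsFiniteLength R M) : Module.length R (M →ₗ[R] E) ≤ Module.length R M := by
  induction hM with
  | of_subsingleton =>
    rw [Module.length_eq_zero, Module.length_eq_zero]
  | @of_simple_quotient M _ _ N _ hN ih =>
    rw [Module.length_eq_add_of_exact N.subtype N.mkQ N.subtype_injective N.mkQ_surjective
      (LinearMap.exact_subtype_mkQ N)]
    let res : (M →ₗ[R] E) →ₗ[R] (N →ₗ[R] E) := LinearMap.lcomp R E N.subtype
    let inf : ((M ⧸ N) →ₗ[R] E) →ₗ[R] (M →ₗ[R] E) := LinearMap.lcomp R E N.mkQ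
    rw [Module.length_eq_add_of_exact (LinearMap.ker res).subtype res.rangeRestrict
      (Submodule.subtype_injective _) res.surjective_rangeRestrict
      (by rw [LinearMap.exact_iff]; simp)]
    have h1 : Module.length R (LinearMap.range res) ≤ Module.length R N :=
      (Module.length_le_of_injective _ (Submodule.subtype_injective _)).trans ih
    have h2 : Module.length R (LinearMap.ker res) ≤ Module.length R (M ⧸ N) := by
      rw [Module.length_eq_one R (M ⧸ N)]
      have hle : LinearMap.ker res ≤ LinearMap.range inf := by
        intro φ hφ
        have hN' : N ≤ LinearMap.ker φ := fun x hx =>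
          LinearMap.congr_fun (LinearMap.mem_ker.1 hφ) ⟨x, hx⟩
        exact ⟨N.liftQ φ hN', N.liftQ_mkQ φ hN'⟩
      exact ((Module.length_le_of_injective _ (Submodule.inclusion_injective hle)).trans
        (Module.length_le_of_surjective inf.rangeRestrict inf.surjective_rangeRestrict)).trans
        (h (M ⧸ N))
    rw [add_comm]
    exact add_le_add h1 h2

theorem exists_isDualizing (R : Type u) [CommRing R] :
    ∃ (E : Type u) (_ : AddCommGroup E) (_ : Module R E), IsDualizing R E := by
  classical
  let T := ∀ m : MaximalSpectrum R, R ⧸ m.asIdeal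
  obtain ⟨I, _, _, j, hI, hj⟩ := exists_injective_embedding R T
  obtain ⟨E, p, hTE, hp, hess⟩ := exists_essential_summand hI (LinearMap.range j)
  have hext : ∀ {A B : Type u} [AddCommGroup A] [AddCommGroup B] [Module R A] [Module R B]
      (i : A →ₗ[R] B) (_ : Function.Injective i) (φ : A →ₗ[R] E), ∃ ψ : B →ₗ[R] E, ψ ∘ₗ i = φ := by
    intro A B _ _ _ _ i hi φ
    obtain ⟨ψ, hψ⟩ := Module.Injective.out i hi (E.subtype ∘ₗ φ)
    refine ⟨p ∘ₗ ψ, LinearMap.ext fun a => ?_⟩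
    simp only [LinearMap.comp_apply] at hψ ⊢
    rw [hψ]
    exact hp _
  refine ⟨E, inferInstance, inferInstance, hext, ?_, length_linearMap_le_of_simple ?_⟩
  · intro M _ _ x hx
    let f := LinearMap.toSpanSingleton R M x
    have hker : LinearMap.ker f ≠ ⊤ := fun h => hx <| by
      have : (1 : R) ∈ LinearMap.ker f := h ▸ Submodule.mem_top
      simpa [f] using this
    obtain ⟨m, hm, hle⟩ := Ideal.exists_le_maximal _ hker
    let q : R ⧸ m →ₗ[R] E := LinearMap.codRestrict E
      (j ∘ₗ LinearMap.single R (fun m : MaximalSpectrum R => R ⧸ m.asIdeal) ⟨m, hm⟩)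
      fun y => hTE ⟨_, rfl⟩
    obtain ⟨ψ, hψ⟩ := hext ((LinearMap.ker f).liftQ f le_rfl)
      (LinearMap.ker_eq_bot.1 (Submodule.ker_liftQ_eq_bot _ _ _ le_rfl))
      (q ∘ₗ Submodule.mapQ (LinearMap.ker f) m LinearMap.id hle)
    refine ⟨ψ, fun h0 => ?_⟩
    have h1 := LinearMap.congr_fun hψ (Submodule.Quotient.mk 1)
    simp only [LinearMap.comp_apply, Submodule.liftQ_apply, Submodule.mapQ_apply,
      LinearMap.id_apply] at h1
    rw [show f 1 = x by simp [f], h0] at h1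
    have h2 := hj ((congrArg Subtype.val h1).symm.trans (map_zero j).symm)
    have h3 := congrFun h2 ⟨m, hm⟩
    rw [LinearMap.single_apply, Pi.single_eq_same] at h3
    exact hm.ne_top ((Ideal.eq_top_iff_one _).2 (Ideal.Quotient.eq_zero_iff_mem.1 h3))
  · intro S _ _ _
    have := IsSimpleModule.nontrivial R S
    by_cases hsub : Subsingleton (S →ₗ[R] E)
    · rw [Module.length_eq_zero]
      exact zero_le
    rw [not_subsingleton_iff_nontrivial] at hsub
    obtain ⟨s, hs⟩ := exists_ne (0 : S)
    have hgen := IsSimpleModule.toSpanSingleton_surjective R hs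
    have hm : (Ideal.torsionOf R S s).IsMaximal := by
      have e : (R ⧸ Ideal.torsionOf R S s) ≃ₗ[R] S :=
        LinearMap.quotKerEquivOfSurjective _ hgen
      exact ⟨isSimpleModule_iff_isCoatom.1 (IsSimpleModule.congr e)⟩
    set m := Ideal.torsionOf R S s with hmdef
    have hms : ∀ a ∈ m, a • s = 0 := fun a ha => (Ideal.mem_torsionOf_iff s a).1 ha
    -- values of homomorphisms at `s` come from the residue field
    have hval : ∀ φ : S →ₗ[R] E, φ ≠ 0 →
        ∃ t : T, j t = φ s ∧ (∀ m', m'.asIdeal ≠ m → t m' = 0) ∧ t ≠ 0 := by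
      intro φ hφ
      have hφs : φ s ≠ 0 := fun h => hφ <| LinearMap.ext fun x => by
        obtain ⟨r, rfl⟩ := hgen x
        simp [h]
      obtain ⟨r, ⟨t, ht⟩, hr0⟩ := hess (φ s) (φ s).2 fun h => hφs (Subtype.ext h)
      have hrm : r ∉ m := fun h => hr0 (by
        rw [← Submodule.coe_smul, ← map_smul, hms r h, map_zero, Submodule.coe_zero])
      obtain ⟨c, i, hi, hci⟩ := hm.exists_inv hrm
      have hjt : j (c • t) = φ s := by
        rw [map_smul, ht, ← mul_smul, eq_sub_of_add_eq hci, sub_smul, one_smul,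
          ← Submodule.coe_smul, ← map_smul, hms i hi, map_zero, Submodule.coe_zero, sub_zero]
      refine ⟨c • t, hjt, fun m' hm' => ?_, fun h => hφs (Subtype.ext ?_)⟩
      · obtain ⟨a, ha, ham⟩ := SetLike.not_le_iff_exists.1 fun hle =>
          hm' (hm.eq_of_le m'.isMaximal.ne_top hle).symm
        have h0 : a • (c • t) = 0 := hj (by
          rw [map_smul, hjt, map_zero, ← Submodule.coe_smul, ← map_smul, hms a ha, map_zero,
            Submodule.coe_zero])
        have h1 : a • (c • t) m' = 0 := congrFun h0 m'
        obtain ⟨y, hy⟩ := Ideal.Quotient.mk_surjective ((c • t) m')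
        rw [← hy] at h1 ⊢
        have h2 : a * y ∈ m'.asIdeal := Ideal.Quotient.eq_zero_iff_mem.1 h1
        exact Ideal.Quotient.eq_zero_iff_mem.2
          ((m'.isMaximal.isPrime.mem_or_mem h2).resolve_left ham)
      · rw [← hjt, h, map_zero, Submodule.coe_zero]
    have : IsSimpleModule R (S →ₗ[R] E) := by
      rw [isSimpleModule_iff_toSpanSingleton_surjective]
      refine ⟨hsub, fun φ hφ ψ => ?_⟩
      by_cases hψ : ψ = 0
      · exact ⟨0, by simp [hψ]⟩
      obtain ⟨t, ht, htm, ht0⟩ := hval φ hφ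
      obtain ⟨t', ht', htm', -⟩ := hval ψ hψ
      obtain ⟨a, ha⟩ := Ideal.Quotient.mk_surjective (t ⟨m, hm⟩)
      obtain ⟨b, hb⟩ := Ideal.Quotient.mk_surjective (t' ⟨m, hm⟩)
      have ham : a ∉ m := fun h => ht0 <| funext fun m' => by
        by_cases hm' : m'.asIdeal = m
        · obtain rfl : m' = ⟨m, hm⟩ := MaximalSpectrum.ext hm'
          rw [← ha]
          exact Ideal.Quotient.eq_zero_iff_mem.2 h
        · exact htm m' hm'
      obtain ⟨c, i, hi, hci⟩ := hm.exists_inv ham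
      have htt : (b * c) • t = t' := funext fun m' => by
        by_cases hm' : m'.asIdeal = m
        · obtain rfl : m' = ⟨m, hm⟩ := MaximalSpectrum.ext hm'
          rw [Pi.smul_apply, ← ha, ← hb]
          refine (Ideal.Quotient.eq (I := m)).2 ?_
          change (b * c) * a - b ∈ m
          rw [show (b * c) * a - b = -(b * i) by
            linear_combination b * hci]
          exact m.neg_mem (m.mul_mem_left _ hi)
        · rw [Pi.smul_apply, htm m' hm', htm' m' hm', smul_zero]
      refine ⟨b * c, LinearMap.ext fun x => ?_⟩
      obtain ⟨r, rfl⟩ := hgen x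
      have hs' : (b * c) • φ s = ψ s := Subtype.ext (by
        rw [Submodule.coe_smul, ← ht, ← ht', ← map_smul, htt])
      simp only [LinearMap.toSpanSingleton_apply, map_smul, LinearMap.smul_apply, hs']
    rw [Module.length_eq_one]

variable {E : Type u} [AddCommGroup E] [Module R E]

theorem IsDualizing.exists_factor (hE : IsDualizing R E) {A B : Type u} [AddCommGroup A]
    [AddCommGroup B] [Module R A] [Module R B] (q : A →ₗ[R] B) (φ : A →ₗ[R] E)
    (h : LinearMap.ker q ≤ LinearMap.ker φ) : ∃ ψ : B →ₗ[R] E, ∀ a, ψ (q a) = φ a := by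
  obtain ⟨ψ, hψ⟩ := hE.extend ((LinearMap.ker q).liftQ q le_rfl)
    (LinearMap.ker_eq_bot.1 (Submodule.ker_liftQ_eq_bot _ _ _ le_rfl))
    ((LinearMap.ker q).liftQ φ h)
  exact ⟨ψ, fun a => LinearMap.congr_fun hψ (Submodule.Quotient.mk a)⟩

theorem IsDualizing.isFiniteLength (hE : IsDualizing R E) {M : Type u} [AddCommGroup M]
    [Module R M] (hM : IsFiniteLength R M) : IsFiniteLength R (M →ₗ[R] E) :=
  Module.length_ne_top_iff.1
    (ne_top_of_le_ne_top (Module.length_ne_top_iff.2 hM) (hE.length_le hM))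

/-- Finite length modules are reflexive. -/
theorem IsDualizing.exists_eval (hE : IsDualizing R E) {M : Type u} [AddCommGroup M]
    [Module R M] (hM : IsFiniteLength R M) (Φ : (M →ₗ[R] E) →ₗ[R] E) :
    ∃ x, ∀ φ, Φ φ = φ x := by
  let ev : M →ₗ[R] ((M →ₗ[R] E) →ₗ[R] E) := LinearMap.flip LinearMap.id
  have hev : Function.Injective ev := by
    rw [injective_iff_map_eq_zero]
    intro x hx
    by_contra h0
    obtain ⟨φ, hφ⟩ := hE.exists_ne_zero h0
    exact hφ (LinearMap.congr_fun hx φ)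
  have h1 := hE.isFiniteLength hM
  have h2 := hE.isFiniteLength h1
  obtain ⟨_, _⟩ := isFiniteLength_iff_isNoetherian_isArtinian.1 hM
  obtain ⟨_, _⟩ := isFiniteLength_iff_isNoetherian_isArtinian.1 h2
  have hl := (hE.length_le h1).trans (hE.length_le hM)
  rw [← coe_mlen, ← coe_mlen] at hl
  obtain ⟨x, hx⟩ := (bijective_of_injective_of_mlen_le ev hev (by exact_mod_cast hl)).2 Φ
  exact ⟨x, fun φ => by rw [← hx]; rfl⟩

end Duality

section Fitting

variable {Λ : Type*} [Ring Λ] {M : Type*} [AddCommGroup M] [Module Λ M]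

theorem IsIndecomposableModule.isNilpotent_or_isUnit [IsArtinian Λ M] [IsNoetherian Λ M]
    (h : IsIndecomposableModule Λ M) (f : Module.End Λ M) : IsNilpotent f ∨ IsUnit f := by
  obtain ⟨n, hn⟩ := f.eventually_isCompl_ker_pow_range_pow.exists_forall_of_atTop
  have hc := hn (n + 1) (Nat.le_succ n)
  rcases h.eq_bot_or_eq_top hc with ⟨hk, hr⟩ | ⟨hk, -⟩
  · right
    rw [← isUnit_pow_iff n.succ_ne_zero, Module.End.isUnit_iff]
    exact ⟨LinearMap.ker_eq_bot.1 hk, LinearMap.range_eq_top.1 hr⟩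
  · exact Or.inl ⟨n + 1, LinearMap.ker_eq_top.1 hk⟩

theorem IsIndecomposableModule.bijective_of_add [IsArtinian Λ M] [IsNoetherian Λ M]
    (h : IsIndecomposableModule Λ M) {f g : Module.End Λ M} (hfg : Function.Bijective (f + g)) :
    Function.Bijective f ∨ Function.Bijective g := by
  simp only [← Module.End.isUnit_iff] at hfg ⊢
  have hcomm : ∀ k : Module.End Λ M, IsUnit (↑hfg.unit⁻¹ * k) ↔ IsUnit k := fun k =>
    Units.isUnit_units_mul _ _
  rcases h.isNilpotent_or_isUnit (↑hfg.unit⁻¹ * f) with hn | hu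
  · right
    rw [← hcomm g]
    have : (↑hfg.unit⁻¹ : Module.End Λ M) * g = 1 - ↑hfg.unit⁻¹ * f := by
      rw [eq_sub_iff_add_eq', ← mul_add]
      exact hfg.unit.inv_mul
    rw [this]
    exact hn.isUnit_one_sub
  · exact Or.inl ((hcomm f).1 hu)

end Fitting

section Coinduced

/-- The coinduced left `Λ`-module `Hom_R(Λ, E)`. -/
def CoindModule (R Λ E : Type u) [CommRing R] [Ring Λ] [Algebra R Λ] [AddCommGroup E]
    [Module R E] : Type u := Λ →ₗ[R] E

namespace CoindModule

variable {R Λ E : Type u} [CommRing R] [Ring Λ] [Algebra R Λ] [AddCommGroup E] [Module R E]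

instance : AddCommGroup (CoindModule R Λ E) := inferInstanceAs (AddCommGroup (Λ →ₗ[R] E))

instance : Module R (CoindModule R Λ E) := inferInstanceAs (Module R (Λ →ₗ[R] E))

/-- The linear form underlying an element of the coinduced module. -/
def form : CoindModule R Λ E →ₗ[R] (Λ →ₗ[R] E) := LinearMap.id

@[ext]
theorem ext {v w : CoindModule R Λ E} (h : ∀ x, form v x = form w x) : v = w :=
  LinearMap.ext h

instance : Module Λ (CoindModule R Λ E) where
  smul l v := (form v ∘ₗ LinearMap.mulRight R l : Λ →ₗ[R] E)
  one_smul v := ext fun x => congrArg (form v) (mul_one x)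
  mul_smul a b v := ext fun x => congrArg (form v) (mul_assoc x a b).symm
  smul_zero _ := rfl
  smul_add _ _ _ := rfl
  add_smul a b v := ext fun x =>
    (congrArg (form v) (mul_add x a b)).trans (map_add (form v) _ _)
  zero_smul v := ext fun x => (congrArg (form v) (mul_zero x)).trans (map_zero (form v))

@[simp]
theorem form_smul (l : Λ) (v : CoindModule R Λ E) (x : Λ) : form (l • v) x = form v (x * l) := rfl

instance : IsScalarTower R Λ (CoindModule R Λ E) where
  smul_assoc r l v := ext fun x => by
    rw [form_smul, mul_smul_comm, map_smul, map_smul]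
    rfl

theorem isNoetherian [IsArtinianRing R] [Module.Finite R Λ] (hE : IsDualizing R E) :
    IsNoetherian Λ (CoindModule R Λ E) := by
  have : IsFiniteLength R Λ := isFiniteLength_iff_isNoetherian_isArtinian.2
    ⟨inferInstance, inferInstance⟩
  have := (isFiniteLength_iff_isNoetherian_isArtinian.1 (hE.isFiniteLength this)).1
  have : IsNoetherian R (CoindModule R Λ E) := this
  exact isNoetherian_of_tower R this

variable {X : Type u} [AddCommGroup X] [Module Λ X] [Module R X] [IsScalarTower R Λ X]

/-- The `Λ`-linear map into the coinduced module attached to an `R`-linear form. -/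
def lift (φ : X →ₗ[R] E) : X →ₗ[Λ] CoindModule R Λ E where
  toFun x := (φ ∘ₗ (LinearMap.toSpanSingleton Λ X x).restrictScalars R : Λ →ₗ[R] E)
  map_add' x y := ext fun l => (congrArg φ (smul_add l x y)).trans (map_add φ _ _)
  map_smul' a x := ext fun l => congrArg φ (mul_smul l a x).symm

end CoindModule

end Coinduced

section AlmostSplit

variable {R Λ E : Type u} [CommRing R] [IsArtinianRing R] [Ring Λ] [Algebra R Λ]
  [Module.Finite R Λ] [AddCommGroup E] [Module R E]

theorem isArtinian_isNoetherian_of_finite (R : Type*) [CommRing R] [IsArtinianRing R] {Λ : Type*}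
    [Ring Λ] [Algebra R Λ] [Module.Finite R Λ] (X : Type*) [AddCommGroup X] [Module Λ X]
    [Module.Finite Λ X] : IsArtinian Λ X ∧ IsNoetherian Λ X := by
  have : IsArtinianRing Λ := isArtinian_of_tower R (inferInstanceAs (IsArtinian R Λ))
  exact ⟨inferInstance, inferInstance⟩

theorem exists_rightAlmostSplit (hE : IsDualizing R E) {Z : Type u} [AddCommGroup Z] [Module Λ Z]
    [Module.Finite Λ Z] (hZ : IsIndecomposableModule Λ Z) :
    ∃ (B : Type u) (_ : AddCommGroup B) (_ : Module Λ B) (g : B →ₗ[Λ] Z), Module.Finite Λ B ∧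
      (¬ ∃ s : Z →ₗ[Λ] B, g ∘ₗ s = LinearMap.id) ∧
      ∀ (X : Type u) [AddCommGroup X] [Module Λ X], IsIndecomposableModule Λ X →
        ∀ f : X →ₗ[Λ] Z, ¬ Function.Bijective f → ∃ f' : X →ₗ[Λ] B, g ∘ₗ f' = f := by
  obtain ⟨_, _⟩ := isArtinian_isNoetherian_of_finite R (Λ := Λ) Z
  let _ : Module R Z := Module.compHom Z (algebraMap R Λ)
  have : IsScalarTower R Λ Z := IsScalarTower.of_compHom R Λ Z
  have := hZ.nontrivial
  -- a finite presentation of `Z`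
  obtain ⟨b, z, hz⟩ := Submodule.fg_iff_exists_fin_generating_family.1
    (Module.Finite.fg_top (R := Λ) (M := Z))
  have hNΛ := (isArtinian_isNoetherian_of_finite R (Λ := Λ) (Fin b → Λ)).2
  obtain ⟨a, m, hm⟩ := Submodule.fg_iff_exists_fin_generating_family.1
    (hNΛ.noetherian (LinearMap.ker (Fintype.linearCombination Λ z)))
  have hmz : ∀ i, ∑ j, m i j • z j = 0 := fun i => by
    have : m i ∈ LinearMap.ker (Fintype.linearCombination Λ z) :=
      hm ▸ Submodule.subset_span ⟨i, rfl⟩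
    exact this
  have hlift : ∀ (X : Type u) [AddCommGroup X] [Module Λ X] (x : Fin b → X),
      (∀ i, ∑ j, m i j • x j = 0) → ∃ g : Z →ₗ[Λ] X, ∀ j, g (z j) = x j := by
    intro X _ _ x hx
    have hsurj : Function.Surjective (Fintype.linearCombination Λ z) := by
      rw [← LinearMap.range_eq_top, Fintype.range_linearCombination, hz]
    have hker : LinearMap.ker (Fintype.linearCombination Λ z) ≤
        LinearMap.ker (Fintype.linearCombination Λ x) := by
      rw [← hm, Submodule.span_le]
      rintro _ ⟨i, rfl⟩
      exact hx i
    refine ⟨(Submodule.liftQ _ (Fintype.linearCombination Λ x) hker) ∘ₗ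
      (LinearMap.quotKerEquivOfSurjective _ hsurj).symm.toLinearMap, fun j => ?_⟩
    have : z j = LinearMap.quotKerEquivOfSurjective _ hsurj
        (Submodule.Quotient.mk (Pi.single j 1)) := by
      simp
    rw [this, LinearMap.comp_apply, LinearEquiv.coe_coe, LinearEquiv.symm_apply_apply,
      Submodule.liftQ_apply]
    simp
  -- a linear form on `End Z` vanishing exactly on non-automorphisms
  let N : Submodule R (Z →ₗ[Λ] Z) :=
    { carrier := {f | ¬ Function.Bijective f}
      zero_mem' := fun h => not_subsingleton Z ⟨fun x y => h.1 rfl⟩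
      add_mem' := fun hf hg hfg => (hZ.bijective_of_add hfg).elim hf hg
      smul_mem' := fun r f hf h => hf (hZ.bijective_of_comp f (r • LinearMap.id) h).1 }
  obtain ⟨χ, hχ⟩ := hE.exists_ne_zero (M := (Z →ₗ[Λ] Z) ⧸ N) (x := N.mkQ LinearMap.id)
    (fun h => (Submodule.Quotient.mk_eq_zero N).1 h Function.bijective_id)
  let ev : (Z →ₗ[Λ] Z) →ₗ[R] (Fin b → Z) :=
    { toFun := fun g j => g (z j)
      map_add' := fun _ _ => rfl
      map_smul' := fun _ _ => rfl }
  have hev : Function.Injective ev := fun f g hfg => by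
    refine LinearMap.ext_on_range hz fun j => congrFun hfg j
  obtain ⟨Θ, hΘ⟩ := hE.extend ev hev (χ ∘ₗ N.mkQ)
  have hΘ0 : ∀ g : Z →ₗ[Λ] Z, ¬ Function.Bijective g → Θ (fun j => g (z j)) = 0 := fun g hg => by
    have h1 : Θ (ev g) = χ (N.mkQ g) := LinearMap.congr_fun hΘ g
    rw [show N.mkQ g = 0 from (Submodule.Quotient.mk_eq_zero N).2 hg, map_zero] at h1
    exact h1
  have hΘ1 : Θ z ≠ 0 := fun h => hχ ((LinearMap.congr_fun hΘ LinearMap.id).symm.trans h)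
  have hsum : ∀ (n : ℕ) (X : Type u) [AddCommGroup X] [Module R X] (φ : (Fin n → X) →ₗ[R] E)
      (x : Fin n → X), φ x = ∑ j, φ (Pi.single j (x j)) := fun n X _ _ φ x => by
    rw [← map_sum, Finset.univ_sum_single]
  let B : Submodule Λ (Z × (Fin a → CoindModule R Λ E)) :=
    { carrier := {w | ∀ j l, Θ (Pi.single j (l • w.1)) = ∑ i, CoindModule.form (w.2 i) (m i j * l)}
      zero_mem' := fun j l => by simp
      add_mem' := fun {w w'} hw hw' j l => by
        simp [Pi.single_add, Finset.sum_add_distrib, hw j l, hw' j l]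
      smul_mem' := fun c w hw j l => by
        simpa [mul_smul, mul_assoc] using hw j (l * c) }
  have hJ := CoindModule.isNoetherian (R := R) (Λ := Λ) hE
  refine ⟨B, inferInstance, inferInstance, LinearMap.fst Λ _ _ ∘ₗ B.subtype, inferInstance, ?_, ?_⟩
  · rintro ⟨s, hs⟩
    refine hΘ1 ?_
    have hs1 : ∀ y, (s y : Z × (Fin a → CoindModule R Λ E)).1 = y := LinearMap.congr_fun hs
    have h1 : ∀ j, Θ (Pi.single j (z j)) =
        ∑ i, CoindModule.form ((s (m i j • z j) : Z × (Fin a → CoindModule R Λ E)).2 i) 1 := by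
      intro j
      have := (s (z j)).2 j 1
      rw [hs1, one_smul] at this
      rw [this]
      refine Finset.sum_congr rfl fun i _ => ?_
      simp
    rw [hsum]
    simp_rw [h1]
    rw [Finset.sum_comm]
    refine Finset.sum_eq_zero fun i _ => ?_
    have h2 : ∑ j, CoindModule.form ((s (m i j • z j) : Z × (Fin a → CoindModule R Λ E)).2 i) 1 =
        CoindModule.form ((s (∑ j, m i j • z j) : Z × (Fin a → CoindModule R Λ E)).2 i) 1 := by
      simp [Prod.snd_sum]
    rw [h2, hmz i]
    simp
  · intro X _ _ hX f hf
    let _ : Module R X := Module.compHom X (algebraMap R Λ)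
    have : IsScalarTower R Λ X := IsScalarTower.of_compHom R Λ X
    let q : (Fin b → X) →ₗ[R] (Fin a → X) :=
      { toFun := fun x i => ∑ j, m i j • x j
        map_add' := fun x y => by ext i; simp [Finset.sum_add_distrib]
        map_smul' := fun r x => by ext i; simp [Finset.smul_sum, smul_comm r] }
    let φ : (Fin b → X) →ₗ[R] E := Θ ∘ₗ LinearMap.compLeft (f.restrictScalars R) (Fin b)
    obtain ⟨Ψ, hΨ⟩ := hE.exists_factor q φ fun x hx => by
      obtain ⟨g, hg⟩ := hlift X x fun i => congrFun (LinearMap.mem_ker.1 hx) i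
      have : φ x = Θ (fun j => (f ∘ₗ g) (z j)) := by
        change Θ (fun j => f (x j)) = _
        simp [hg]
      rw [LinearMap.mem_ker, this]
      exact hΘ0 _ fun h => hf (hX.bijective_of_comp g f h).2
    refine ⟨LinearMap.codRestrict B (LinearMap.prod f (LinearMap.pi fun i =>
      CoindModule.lift (Ψ ∘ₗ LinearMap.single R (fun _ => X) i))) fun x j l => ?_, rfl⟩
    have h1 : Θ (Pi.single j (l • f x)) = φ (Pi.single j (l • x)) := by
      change _ = Θ (fun k => f ((Pi.single j (l • x) : Fin b → X) k))
      congr 1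
      ext k
      rcases eq_or_ne k j with rfl | hk <;> simp [*]
    have h2 : q (Pi.single j (l • x)) = fun i => (m i j * l) • x := by
      ext i
      change ∑ k, m i k • (Pi.single j (l • x) : Fin b → X) k = _
      rw [Finset.sum_eq_single j (fun k _ hk => by simp [hk]) (by simp), Pi.single_eq_same,
        mul_smul]
    have h3 := (h1.trans (hΨ _).symm).trans ((congrArg Ψ h2).trans (hsum _ _ _ _))
    exact h3

end AlmostSplit

section HaradaSai

variable {Λ : Type*} [Ring Λ]

theorem mlen_range_comp_lt {P B C D : Type*} [AddCommGroup P] [Module Λ P] [AddCommGroup B]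
    [Module Λ B] [AddCommGroup C] [Module Λ C] [AddCommGroup D] [Module Λ D]
    [IsArtinian Λ B] [IsNoetherian Λ B] [IsArtinian Λ C] [IsNoetherian Λ C]
    (hB : IsIndecomposableModule Λ B) (hC : IsIndecomposableModule Λ C)
    (f : P →ₗ[Λ] B) (g : B →ₗ[Λ] C) (h : C →ₗ[Λ] D) (hg : ¬ Function.Bijective g)
    (h0 : h ∘ₗ g ∘ₗ f ≠ 0) {k : ℕ} (hf : mlen Λ (LinearMap.range f) ≤ k)
    (hh : mlen Λ (LinearMap.range h) ≤ k) : mlen Λ (LinearMap.range (h ∘ₗ g ∘ₗ f)) < k := by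
  by_contra! hk
  have hartin : IsArtinian Λ (LinearMap.range h) :=
    isArtinian_of_surjective _ h.rangeRestrict h.surjective_rangeRestrict
  have hnoeth : IsNoetherian Λ (LinearMap.range h) :=
    isNoetherian_of_surjective h.rangeRestrict (LinearMap.range_eq_top.2 h.surjective_rangeRestrict)
  have hle : LinearMap.range (h ∘ₗ g ∘ₗ f) ≤ LinearMap.range h := LinearMap.range_comp_le_range _ _
  have hrange : ∀ y, ∃ p, h (g (f p)) = h y := fun y => by
    have hinc := bijective_of_injective_of_mlen_le (Submodule.inclusion hle)
      (Submodule.inclusion_injective hle) (hh.trans hk)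
    obtain ⟨⟨_, p, rfl⟩, hp⟩ := hinc.2 ⟨h y, y, rfl⟩
    exact ⟨p, congrArg Subtype.val hp⟩
  have hdisj : ∀ p, h (g (f p)) = 0 → f p = 0 := by
    let q : LinearMap.range f →ₗ[Λ] D := h ∘ₗ g ∘ₗ (LinearMap.range f).subtype
    have h1 := mlen_ker_add_mlen_range q
    have hq : LinearMap.range q = LinearMap.range (h ∘ₗ g ∘ₗ f) := by
      ext d
      constructor
      · rintro ⟨⟨_, p, rfl⟩, rfl⟩
        exact ⟨p, rfl⟩
      · rintro ⟨p, rfl⟩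
        exact ⟨⟨_, p, rfl⟩, rfl⟩
    rw [hq] at h1
    have := mlen_eq_zero (Λ := Λ) (M := LinearMap.ker q) (by omega)
    intro p hp
    have h2 : (⟨⟨f p, p, rfl⟩, hp⟩ : LinearMap.ker q) = 0 := Subsingleton.elim _ _
    exact congrArg (fun y : LinearMap.ker q => ((y : LinearMap.range f) : B)) h2
  have hcB : IsCompl (LinearMap.range f) (LinearMap.ker (h ∘ₗ g)) := by
    rw [isCompl_iff, Submodule.disjoint_def, codisjoint_iff, eq_top_iff]
    refine ⟨?_, fun y _ => ?_⟩
    · rintro _ ⟨p, rfl⟩ hp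
      exact hdisj p hp
    · obtain ⟨p, hp⟩ := hrange (g y)
      refine Submodule.mem_sup.2 ⟨f p, ⟨p, rfl⟩, y - f p, ?_, by abel⟩
      simp [hp]
  have hinj : Function.Injective (h ∘ₗ g) := by
    rcases hB.eq_bot_or_eq_top hcB with ⟨h1, -⟩ | ⟨-, h1⟩
    · exact absurd
        (by rw [LinearMap.range_eq_bot.1 h1, LinearMap.comp_zero, LinearMap.comp_zero]) h0
    · exact LinearMap.ker_eq_bot.1 h1
  have hcC : IsCompl (LinearMap.range g) (LinearMap.ker h) := by
    rw [isCompl_iff, Submodule.disjoint_def, codisjoint_iff, eq_top_iff]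
    refine ⟨?_, fun y _ => ?_⟩
    · rintro _ ⟨p, rfl⟩ hp
      rw [hinj (hp.trans (map_zero (h ∘ₗ g)).symm), map_zero]
    · obtain ⟨p, hp⟩ := hrange y
      refine Submodule.mem_sup.2 ⟨g (f p), ⟨f p, rfl⟩, y - g (f p), ?_, by abel⟩
      simp [hp]
  rcases hC.eq_bot_or_eq_top hcC with ⟨h1, -⟩ | ⟨h1, -⟩
  · exact h0 (by rw [LinearMap.range_eq_bot.1 h1, LinearMap.zero_comp, LinearMap.comp_zero])
  · exact hg ⟨fun x y hxy => hinj (congrArg h hxy), LinearMap.range_eq_top.1 h1⟩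

end HaradaSai

section Landing

variable {R Λ E : Type u} [CommRing R] [IsArtinianRing R] [Ring Λ] [Algebra R Λ]
  [Module.Finite R Λ] [AddCommGroup E] [Module R E]

/-- A finitely generated indecomposable bundled module. -/
def BundledMod.IsFGIndec {Λ : Type u} [Ring Λ] (M : BundledMod Λ) : Prop :=
  Module.Finite Λ M.carrier ∧ IsIndecomposableModule Λ M.carrier

theorem exists_sink_family (hE : IsDualizing R E) {Z : BundledMod Λ} (hZ : Z.IsFGIndec) :
    ∃ (k : ℕ) (B : Fin k → BundledMod Λ) (g : ∀ j, (B j).carrier →ₗ[Λ] Z.carrier),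
      (∀ j, (B j).IsFGIndec) ∧ (∀ j, ¬ Function.Bijective (g j)) ∧
      ∀ X : BundledMod Λ, X.IsFGIndec → ∀ f : X.carrier →ₗ[Λ] Z.carrier,
        ¬ Function.Bijective f →
          ∃ f' : ∀ j, X.carrier →ₗ[Λ] (B j).carrier, ∀ x, ∑ j, g j (f' j x) = f x := by
  have := hZ.1
  obtain ⟨B, _, _, g, _, hg, hB⟩ := exists_rightAlmostSplit hE hZ.2
  obtain ⟨_, _⟩ := isArtinian_isNoetherian_of_finite R (Λ := Λ) B
  obtain ⟨k, P, p, hP, -, hp⟩ := exists_indecomposable_decomposition (Λ := Λ) (M := B)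
  refine ⟨k, fun j => ⟨P j⟩, fun j => g ∘ₗ (P j).subtype, fun j => ⟨inferInstance, hP j⟩,
    fun j hj => hg ?_, fun X hX f hf => ?_⟩
  · refine ⟨(P j).subtype ∘ₗ (LinearEquiv.ofBijective _ hj).symm.toLinearMap,
      LinearMap.ext fun z => ?_⟩
    exact (LinearEquiv.ofBijective (g ∘ₗ (P j).subtype) hj).apply_symm_apply z
  · obtain ⟨f', rfl⟩ := hB X.carrier hX.2 f hf
    refine ⟨fun j => p j ∘ₗ f', fun x => ?_⟩
    simp only [LinearMap.comp_apply, Submodule.subtype_apply]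
    rw [← map_sum, hp]

theorem exists_finite_landing_set (hE : IsDualizing R E) (A : BundledMod Λ → Prop) (b : ℕ)
    (hA : ∀ Y : BundledMod Λ, Y.IsFGIndec → A Y → mlen Λ Y.carrier ≤ b) (m : ℕ)
    {Z : BundledMod Λ} (hZ : Z.IsFGIndec) :
    ∃ 𝒴 : Set (BundledMod Λ), 𝒴.Finite ∧ (∀ Y ∈ 𝒴, Y.IsFGIndec) ∧
      ∀ X : BundledMod Λ, X.IsFGIndec → ∀ (f : X.carrier →ₗ[Λ] Z.carrier)
        (K : Submodule Λ Z.carrier) (x : X.carrier), f x ∉ K →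
        ∃ Y ∈ 𝒴, ∃ (f' : X.carrier →ₗ[Λ] Y.carrier) (c : Y.carrier →ₗ[Λ] Z.carrier),
          c (f' x) ∉ K ∧ (¬ A Y ∨ Function.Bijective f' ∨ mlen Λ (LinearMap.range c) + m ≤ b) := by
  induction m generalizing Z with
  | zero =>
    refine ⟨{Z}, Set.finite_singleton _, by simpa using hZ, fun X hX f K x hx =>
      ⟨Z, rfl, f, LinearMap.id, hx, ?_⟩⟩
    by_cases hAZ : A Z
    · have := hZ.1
      obtain ⟨_, _⟩ := isArtinian_isNoetherian_of_finite R (Λ := Λ) Z.carrier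
      refine Or.inr (Or.inr ((mlen_le_of_surjective (LinearMap.rangeRestrict LinearMap.id)
        (LinearMap.surjective_rangeRestrict _)).trans (hA Z hZ hAZ)))
    · exact Or.inl hAZ
  | succ m ih =>
    obtain ⟨𝒴, hfin, h𝒴, hland⟩ := ih hZ
    choose k B g hB hg hf' using fun Y : 𝒴 => exists_sink_family hE (h𝒴 Y Y.2)
    choose 𝒲 hfin' h𝒲 hland' using fun (Y : 𝒴) (j : Fin (k Y)) => ih (hB Y j)
    have : Finite 𝒴 := hfin
    refine ⟨𝒴 ∪ ⋃ (Y : 𝒴) (j : Fin (k Y)), 𝒲 Y j,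
      hfin.union (Set.finite_iUnion fun Y => Set.finite_iUnion fun j => hfin' Y j), ?_, ?_⟩
    · rintro W (hW | hW)
      · exact h𝒴 W hW
      · simp only [Set.mem_iUnion] at hW
        obtain ⟨Y, j, hW⟩ := hW
        exact h𝒲 Y j W hW
    · intro X hX f K x hx
      obtain ⟨Y, hY, f', c, hc, halt⟩ := hland X hX f K x hx
      by_cases halt' : ¬ A Y ∨ Function.Bijective f'
      · exact ⟨Y, Or.inl hY, f', c, hc, by tauto⟩
      · push Not at halt'
        have hlen : mlen Λ (LinearMap.range c) + m ≤ b := by tauto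
        obtain ⟨fj, hfj⟩ := hf' ⟨Y, hY⟩ X hX f' halt'.2
        obtain ⟨j, hj⟩ : ∃ j, c (g ⟨Y, hY⟩ j (fj j x)) ∉ K := by
          by_contra! hall
          refine hc ?_
          rw [← hfj x, map_sum]
          exact Submodule.sum_mem _ fun j _ => hall j
        obtain ⟨W, hW, f'', c', hc', halt''⟩ := hland' ⟨Y, hY⟩ j X hX (fj j)
          (K.comap (c ∘ₗ g ⟨Y, hY⟩ j)) x hj
        refine ⟨W, Or.inr (Set.mem_iUnion₂.2 ⟨⟨Y, hY⟩, j, hW⟩), f'',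
          c ∘ₗ g ⟨Y, hY⟩ j ∘ₗ c', hc', ?_⟩
        rcases halt'' with h | h | h
        · exact Or.inl h
        · exact Or.inr (Or.inl h)
        · right; right
          have hBj := hB ⟨Y, hY⟩ j
          have := hBj.1
          have := (h𝒴 Y hY).1
          obtain ⟨_, _⟩ := isArtinian_isNoetherian_of_finite R (Λ := Λ) Y.carrier
          obtain ⟨_, _⟩ := isArtinian_isNoetherian_of_finite R (Λ := Λ) (B ⟨Y, hY⟩ j).carrier
          have hlt := mlen_range_comp_lt hBj.2 (h𝒴 Y hY).2 c' (g ⟨Y, hY⟩ j) c (hg ⟨Y, hY⟩ j)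
            (fun h0 => hc' (by
              have h1 : c (g ⟨Y, hY⟩ j (c' (f'' x))) = 0 := LinearMap.congr_fun h0 (f'' x)
              rw [Submodule.mem_comap, LinearMap.comp_apply, h1]
              exact K.zero_mem))
            (k := b - m) (by omega) (by omega)
          omega

/-- If `A` is a class of indecomposable modules of bounded length, then finitely many
indecomposables suffice to detect elements: nonzero elements of an indecomposable `X` survive under
a map to one of them, which either lies outside `A` or is isomorphic to `X`. -/
theorem exists_finite_detecting_set (hE : IsDualizing R E) (A : BundledMod Λ → Prop) (b : ℕ)
    (hA : ∀ Y : BundledMod Λ, Y.IsFGIndec → A Y → mlen Λ Y.carrier ≤ b) :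
    ∃ 𝒴 : Set (BundledMod Λ), 𝒴.Finite ∧ (∀ Y ∈ 𝒴, Y.IsFGIndec) ∧
      ∀ X : BundledMod Λ, X.IsFGIndec → ∀ x : X.carrier, x ≠ 0 →
        ∃ Y ∈ 𝒴, ∃ f : X.carrier →ₗ[Λ] Y.carrier, f x ≠ 0 ∧ (¬ A Y ∨ Function.Bijective f) := by
  have hJ := CoindModule.isNoetherian (R := R) (Λ := Λ) hE
  obtain ⟨_, _⟩ := isArtinian_isNoetherian_of_finite R (Λ := Λ) (CoindModule R Λ E)
  obtain ⟨k, P, p, hP, -, hp⟩ :=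
    exists_indecomposable_decomposition (Λ := Λ) (M := CoindModule R Λ E)
  have hPB : ∀ j, (BundledMod.mk (Λ := Λ) (P j)).IsFGIndec := fun j => ⟨inferInstance, hP j⟩
  choose 𝒲 hfin h𝒲 hland using fun j => exists_finite_landing_set hE A b hA (b + 1) (hPB j)
  refine ⟨⋃ j, 𝒲 j, Set.finite_iUnion hfin, fun Y hY => ?_, fun X hX x hx => ?_⟩
  · obtain ⟨j, hj⟩ := Set.mem_iUnion.1 hY
    exact h𝒲 j Y hj
  · let _ : Module R X.carrier := Module.compHom X.carrier (algebraMap R Λ)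
    have : IsScalarTower R Λ X.carrier := IsScalarTower.of_compHom R Λ X.carrier
    obtain ⟨φ, hφ⟩ := hE.exists_ne_zero hx
    let ℓ : X.carrier →ₗ[Λ] CoindModule R Λ E := CoindModule.lift φ
    have hℓ : ℓ x ≠ 0 := fun h => hφ (by
      have h1 : CoindModule.form (ℓ x) 1 = φ ((1 : Λ) • x) := rfl
      rw [one_smul, h] at h1
      rw [← h1]
      simp)
    obtain ⟨j, hj⟩ : ∃ j, p j (ℓ x) ≠ 0 := by
      by_contra! hall
      refine hℓ ?_
      rw [← hp (ℓ x)]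
      simp [hall]
    obtain ⟨Y, hY, f', c, hc, halt⟩ := hland j X hX (p j ∘ₗ ℓ) ⊥ x (by simpa using hj)
    refine ⟨Y, Set.mem_iUnion.2 ⟨j, hY⟩, f', fun h => hc (by simp [h]), ?_⟩
    rcases halt with h | h | h
    · exact Or.inl h
    · exact Or.inr h
    · omega

end Landing

section Generators

variable {Λ : Type*} [Ring Λ] {M N : Type*} [AddCommGroup M] [Module Λ M]
  [AddCommGroup N] [Module Λ N]

theorem exists_generators_of_mlen_le [IsArtinian Λ M] [IsNoetherian Λ M] {b : ℕ}
    (hb : mlen Λ M ≤ b) : ∃ d : Fin b → M, Submodule.span Λ (Set.range d) = ⊤ := by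
  induction b generalizing M with
  | zero =>
    have := mlen_eq_zero (Λ := Λ) (M := M) (by omega)
    exact ⟨0, Subsingleton.elim _ _⟩
  | succ b ih =>
    rcases subsingleton_or_nontrivial M with hM | hM
    · exact ⟨0, Subsingleton.elim _ _⟩
    obtain ⟨P, hP, -⟩ := (eq_top_or_exists_le_coatom (⊥ : Submodule Λ M)).resolve_left bot_ne_top
    have := Submodule.mlen_lt hP.1
    obtain ⟨d, hd⟩ := ih (M := P) (by omega)
    obtain ⟨x, -, hx⟩ := SetLike.exists_of_lt (lt_top_iff_ne_top.2 hP.1)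
    refine ⟨Fin.cons x (fun i => d i), ?_⟩
    have hPle : P ≤ Submodule.span Λ
        (Set.range (Fin.cons x (fun i => (d i : M)) : Fin (b + 1) → M)) := by
      have h1 : P ≤ (Submodule.span Λ (Set.range d)).map P.subtype := by simp [hd]
      refine h1.trans ?_
      rw [Submodule.map_span]
      refine Submodule.span_mono ?_
      rintro _ ⟨_, ⟨i, rfl⟩, rfl⟩
      exact ⟨i.succ, rfl⟩
    refine hP.2 _ (lt_of_le_of_ne hPle fun h => hx ?_)
    rw [h]
    exact Submodule.subset_span ⟨0, rfl⟩

theorem mlen_prod [IsArtinian Λ M] [IsNoetherian Λ M] [IsArtinian Λ N] [IsNoetherian Λ N] :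
    mlen Λ (M × N) = mlen Λ M + mlen Λ N := by
  have := Module.length_prod Λ M N
  rw [← coe_mlen, ← coe_mlen, ← coe_mlen] at this
  exact_mod_cast this

theorem mlen_fin_fun [IsArtinian Λ M] [IsNoetherian Λ M] (n : ℕ) :
    mlen Λ (Fin n → M) = n * mlen Λ M := by
  have := Module.length_pi (R := Λ) (M := M) (ι := Fin n)
  rw [← coe_mlen, ← coe_mlen, ENat.card_eq_coe_fintype_card, Fintype.card_fin] at this
  exact_mod_cast this

end Generators

section Bound

variable {R Λ E : Type u} [CommRing R] [IsArtinianRing R] [Ring Λ] [Algebra R Λ]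
  [Module.Finite R Λ] [AddCommGroup E] [Module R E]

theorem mlen_le_of_almost_split_inclusion (hE : IsDualizing R E) (n : ℕ) :
    ∃ N : ℕ, ∀ (Y : Type u) [AddCommGroup Y] [Module Λ Y], Module.Finite Λ Y →
      ∀ X : Submodule Λ Y, mlen Λ X ≤ n → (¬ ∃ r : Y →ₗ[Λ] X, ∀ x : X, r x = x) →
      (∀ Y' : Submodule Λ Y, X ≤ Y' → Y' ≠ ⊤ →
        ∃ r : Y' →ₗ[Λ] X, ∀ (x : Y') (hx : (x : Y) ∈ X), r x = ⟨x, hx⟩) →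
      mlen Λ Y ≤ N := by
  let L := mlen R Λ
  refine ⟨n + n * L * L * mlen Λ Λ, fun Y _ _ _ X hXn hX hret => ?_⟩
  have := (isArtinian_isNoetherian_of_finite R (Λ := Λ) Λ).1
  have := (isArtinian_isNoetherian_of_finite R (Λ := Λ) Λ).2
  obtain ⟨_, _⟩ := isArtinian_isNoetherian_of_finite R (Λ := Λ) Y
  let _ : Module R Y := Module.compHom Y (algebraMap R Λ)
  have : IsScalarTower R Λ Y := IsScalarTower.of_compHom R Λ Y
  -- the `R`-length of `X`
  obtain ⟨x, hx⟩ := exists_generators_of_mlen_le hXn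
  have hsurj : Function.Surjective (Fintype.linearCombination Λ x) := by
    rw [← LinearMap.range_eq_top, Fintype.range_linearCombination, hx]
  have hXR : Module.Finite R X :=
    Module.Finite.of_surjective ((Fintype.linearCombination Λ x).restrictScalars R) hsurj
  have hXfl : IsFiniteLength R X := isFiniteLength_iff_isNoetherian_isArtinian.2
    ⟨inferInstance, inferInstance⟩
  have hXL : mlen R X ≤ n * L := by
    rw [← mlen_fin_fun]
    exact mlen_le_of_surjective ((Fintype.linearCombination Λ x).restrictScalars R) hsurj
  obtain ⟨_, _⟩ := isFiniteLength_iff_isNoetherian_isArtinian.1 (hE.isFiniteLength hXfl)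
  have hDL : mlen R (X →ₗ[R] E) ≤ n * L := by
    have := hE.length_le hXfl
    rw [← coe_mlen, ← coe_mlen] at this
    exact le_trans (by exact_mod_cast this) hXL
  obtain ⟨d, hd⟩ := exists_generators_of_mlen_le hDL
  have hd0 : ∀ u : X, (∀ j, d j u = 0) → u = 0 := fun u hu => by
    by_contra hu0
    obtain ⟨φ, hφ⟩ := hE.exists_ne_zero hu0
    have hle : Submodule.span R (Set.range d) ≤ LinearMap.ker (LinearMap.applyₗ (R := R) u) :=
      Submodule.span_le.2 (by rintro _ ⟨j, rfl⟩; exact hu j)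
    rw [hd] at hle
    exact hφ (hle (Submodule.mem_top (x := φ)))
  let π : (Fin (n * L) → Λ) →ₗ[R] (X →ₗ[R] E) :=
    { toFun := fun m => ∑ j, d j ∘ₗ Algebra.lsmul R R X (m j)
      map_add' := fun m m' => by simp [LinearMap.comp_add, Finset.sum_add_distrib]
      map_smul' := fun r m => by simp [LinearMap.comp_smul, Finset.smul_sum] }
  have hπ : ∀ m u, π m u = ∑ j, d j (m j • u) := fun m u => by
    simp [π]
  have hker : mlen R (LinearMap.ker π) ≤ n * L * L := by
    refine (mlen_le_of_injective (LinearMap.ker π).subtype (Submodule.subtype_injective _)).trans ?_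
    rw [mlen_fin_fun]
  obtain ⟨m, hm⟩ := exists_generators_of_mlen_le hker
  have hm0 : ∀ i u, ∑ j, d j ((m i : Fin (n * L) → Λ) j • u) = 0 := fun i u => by
    rw [← hπ, show π (m i) = 0 from (m i).2, LinearMap.zero_apply]
  let q : (Fin (n * L * L) → Y) →ₗ[R] (Fin (n * L) → Y) :=
    { toFun := fun y j => ∑ i, (m i : Fin (n * L) → Λ) j • y i
      map_add' := fun x y => by ext i; simp [Finset.sum_add_distrib]
      map_smul' := fun r x => by ext i; simp [Finset.smul_sum, smul_comm r] }
  let δ : (Fin (n * L) → X) →ₗ[R] E := ∑ j, d j ∘ₗ LinearMap.proj j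
  have hδ : ∀ τ, δ τ = ∑ j, d j (τ j) := fun τ => by simp [δ]
  by_cases hcase : ∀ y, ∀ τ : Fin (n * L) → X, (∀ j, q y j = τ j) → δ τ = 0
  · exfalso
    obtain ⟨G, hG⟩ := hE.exists_factor
      (LinearMap.coprod (LinearMap.compLeft (X.subtype.restrictScalars R) (Fin (n * L))) q)
      (δ ∘ₗ LinearMap.fst R _ _) (by
        rintro ⟨τ, y⟩ hτ
        have h1 : ∀ j, (τ j : Y) + q y j = 0 := fun j => congrFun (LinearMap.mem_ker.1 hτ) j
        refine hcase (-y) τ fun j => ?_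
        rw [map_neg, Pi.neg_apply, eq_neg_of_add_eq_zero_left (h1 j)])
    have hGq : ∀ y, G (q y) = 0 := fun y => by simpa using hG (0, y)
    have hGX : ∀ τ : Fin (n * L) → X, G (fun j => τ j) = δ τ := fun τ => by
      have := hG (τ, 0)
      rw [LinearMap.coprod_apply, map_zero, add_zero] at this
      exact this
    have hg : ∀ y : Y, ∃ u : X, ∀ l : Fin (n * L) → Λ,
        ∑ j, d j (l j • u) = G (fun j => l j • y) := by
      intro y
      let γ : (Fin (n * L) → Λ) →ₗ[R] E := G ∘ₗ
        LinearMap.compLeft ((LinearMap.toSpanSingleton Λ Y y).restrictScalars R) (Fin (n * L))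
      obtain ⟨Φ, hΦ⟩ := hE.exists_factor π γ (by
        have h1 : LinearMap.ker π =
            (Submodule.span R (Set.range m)).map (LinearMap.ker π).subtype := by
          simp [hm]
        rw [h1, Submodule.map_span, Submodule.span_le]
        rintro _ ⟨_, ⟨i, rfl⟩, rfl⟩
        have h2 : γ (m i) = G (q (Pi.single i y)) := by
          refine congrArg G (funext fun j => ?_)
          change (m i : Fin (n * L) → Λ) j • y =
            ∑ k, (m k : Fin (n * L) → Λ) j • (Pi.single i y : _ → Y) k
          rw [Finset.sum_eq_single i (fun k _ hk => by simp [hk]) (by simp), Pi.single_eq_same]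
        exact h2.trans (hGq _))
      obtain ⟨u, hu⟩ := hE.exists_eval hXfl Φ
      refine ⟨u, fun l => ?_⟩
      rw [← hπ, ← hu, hΦ]
      rfl
    choose g hg using hg
    have huniq : ∀ u v : X, (∀ l : Fin (n * L) → Λ, ∑ j, d j (l j • u) = ∑ j, d j (l j • v)) →
        u = v := fun u v h => by
      rw [← sub_eq_zero]
      refine hd0 _ fun j => ?_
      have := h (Pi.single j 1)
      rw [Finset.sum_eq_single j (fun k _ hk => by simp [hk]) (by simp),
        Finset.sum_eq_single j (fun k _ hk => by simp [hk]) (by simp)] at this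
      simpa [sub_eq_zero] using this
    refine hX ⟨{ toFun := g, map_add' := fun y y' => ?_, map_smul' := fun c y => ?_ }, fun x => ?_⟩
    · refine huniq _ _ fun l => ?_
      rw [hg]
      simp only [smul_add, map_add, Finset.sum_add_distrib, hg]
      rw [← map_add]
      rfl
    · refine huniq _ _ fun l => ?_
      rw [hg]
      have := hg y (fun j => l j * c)
      simp only [mul_smul] at this
      exact this.symm
    · refine huniq _ _ fun l => ?_
      change ∑ j, d j (l j • g x) = _
      rw [hg, ← hδ, ← hGX]
      rfl
  · push Not at hcase
    obtain ⟨y, τ, hτ, hδτ⟩ := hcase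
    have htop : X ⊔ Submodule.span Λ (Set.range y) = ⊤ := by
      by_contra hne
      obtain ⟨r, hr⟩ := hret _ le_sup_left hne
      have hy : ∀ i, y i ∈ X ⊔ Submodule.span Λ (Set.range y) := fun i =>
        (le_sup_right : _ ≤ X ⊔ Submodule.span Λ (Set.range y)) (Submodule.subset_span ⟨i, rfl⟩)
      have h1 : ∀ j, τ j = ∑ i, (m i : Fin (n * L) → Λ) j • r ⟨y i, hy i⟩ := fun j => by
        have h2 : (⟨τ j, le_sup_left (a := X) (τ j).2⟩ :
            (X ⊔ Submodule.span Λ (Set.range y) : Submodule Λ Y)) =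
            ∑ i, (m i : Fin (n * L) → Λ) j • ⟨y i, hy i⟩ := by
          apply Subtype.ext
          simpa [q] using (hτ j).symm
        have h3 := hr ⟨τ j, le_sup_left (a := X) (τ j).2⟩ (τ j).2
        have h4 := (congrArg r h2).symm.trans h3
        simp_rw [map_sum, map_smul] at h4
        exact h4.symm
      refine hδτ ?_
      rw [hδ]
      simp_rw [h1, map_sum]
      rw [Finset.sum_comm]
      exact Finset.sum_eq_zero fun i _ => hm0 i _
    have hle := mlen_le_of_surjective (Λ := Λ)
      (LinearMap.coprod X.subtype (Fintype.linearCombination Λ y)) (by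
        rw [← LinearMap.range_eq_top, LinearMap.range_coprod, Fintype.range_linearCombination,
          Submodule.range_subtype, htop])
    rw [mlen_prod, mlen_fin_fun] at hle
    omega

end Bound

section Successor

variable {Λ : Type u} [Ring Λ]

theorem IsGRMeasureOf.inter_Iic [IsArtinianRing Λ] {J : Set ℕ} (hJ : IsGRMeasureOf Λ J) {m : ℕ}
    (hm : m ∈ J) : IsGRMeasureOf Λ (J ∩ Set.Iic m) := by
  obtain ⟨M, _, _, _, hM, rfl⟩ := hJ
  have := hM.nontrivial
  obtain ⟨Z, hZ, -, hμ⟩ := exists_submodule_grMeasure_eq hm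
  exact ⟨Z, inferInstance, inferInstance, inferInstance, hZ, hμ⟩

/-- A Gabriel–Roiter measure strictly between a measure `I` and a larger one, obtained from `I` by
cutting and adding a single number. -/
theorem IsGRMeasureOf.exists_insert [IsArtinianRing Λ] {I J : Set ℕ} (hJ : IsGRMeasureOf Λ J)
    (hIJ : GRlt I J) :
    ∃ m ∈ J, m ∉ I ∧ (∀ k < m, (k ∈ I ↔ k ∈ J)) ∧
      IsGRMeasureOf Λ (insert m (I ∩ Set.Iio m)) := by
  obtain ⟨m, hmJ, hmI, hk⟩ := grlt_iff.1 hIJ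
  refine ⟨m, hmJ, hmI, hk, ?_⟩
  convert hJ.inter_Iic hmJ using 1
  ext k
  simp only [Set.mem_insert_iff, Set.mem_inter_iff, Set.mem_Iio, Set.mem_Iic]
  constructor
  · rintro (rfl | ⟨h1, h2⟩)
    · exact ⟨hmJ, le_rfl⟩
    · exact ⟨(hk k h2).1 h1, h2.le⟩
  · rintro ⟨h1, h2⟩
    rcases h2.eq_or_lt with rfl | h2
    · exact Or.inl rfl
    · exact Or.inr ⟨(hk k h2).2 h1, h2⟩

variable {R E : Type u} [CommRing R] [IsArtinianRing R] [Algebra R Λ]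
  [Module.Finite R Λ] [AddCommGroup E] [Module R E]

/-- The numbers by which a Gabriel–Roiter measure can be extended are bounded. -/
theorem bddAbove_setOf_isGRMeasureOf_insert (hE : IsDualizing R E) {I : Set ℕ}
    (hI : IsGRMeasureOf Λ I) :
    BddAbove {m | m ∉ I ∧ IsGRMeasureOf Λ (insert m (I ∩ Set.Iio m))} := by
  have : IsArtinianRing Λ := (isArtinian_isNoetherian_of_finite R (Λ := Λ) Λ).1
  obtain ⟨M, _, _, _, hM, rfl⟩ := hI
  have := hM.nontrivial
  set n := mlen Λ M
  obtain ⟨N, hN⟩ := mlen_le_of_almost_split_inclusion (Λ := Λ) hE n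
  refine ⟨max n N, ?_⟩
  rintro m ⟨hmI, Y, _, _, _, hY, hμ⟩
  have := hY.nontrivial
  rcases le_or_gt m n with hmn | hmn
  · exact hmn.trans (le_max_left _ _)
  have hIm : grMeasure Λ M ∩ Set.Iio m = grMeasure Λ M :=
    Set.inter_eq_left.2 fun k hk => (grMeasure_subset hk).2.trans_lt hmn
  rw [hIm] at hμ
  have hYm : mlen Λ Y = m := by
    have h1 := mlen_mem_grMeasure hY
    have h2 : m ≤ mlen Λ Y := (grMeasure_subset (hμ ▸ Or.inl rfl : m ∈ grMeasure Λ Y)).2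
    rw [hμ] at h1
    rcases h1 with h1 | h1
    · exact h1
    · exact absurd (grMeasure_subset h1).2 (by omega)
  obtain ⟨X, hX, hXn, hXμ⟩ := exists_submodule_grMeasure_eq (Λ := Λ) (M := Y) (n := n)
    (hμ ▸ Or.inr (mlen_mem_grMeasure hM))
  have hXI : grMeasure Λ X = grMeasure Λ M := by
    rw [hXμ, hμ]
    ext k
    constructor
    · rintro ⟨rfl | hk, hkn⟩
      · exact absurd hkn (not_le.2 hmn)
      · exact hk
    · exact fun hk => ⟨Or.inr hk, (grMeasure_subset hk).2⟩
  have := hX.nontrivial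
  refine le_trans ?_ (le_max_right _ _)
  rw [← hYm]
  refine hN Y inferInstance X hXn.le ?_ fun Y' hXY' hY' => ?_
  · rintro ⟨r, hr⟩
    have h1 : Function.Bijective (r ∘ₗ X.subtype) := by
      rw [show r ∘ₗ X.subtype = LinearMap.id from LinearMap.ext hr]
      exact Function.bijective_id
    have h2 := (LinearEquiv.ofBijective _ (hY.bijective_of_comp X.subtype r h1).2).mlen_eq
    omega
  · obtain ⟨k, P, p, hP, -, hp⟩ := exists_indecomposable_decomposition (Λ := Λ) (M := Y')
    obtain ⟨j, h | h⟩ := exists_grMeasure_lt_or_bijective hX hP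
      (fun j => p j ∘ₗ Submodule.inclusion hXY') (fun x hx => by
        have h1 := hp (Submodule.inclusion hXY' x)
        rw [Finset.sum_eq_zero fun j _ => by
          rw [show p j (Submodule.inclusion hXY' x) = 0 from hx j, Submodule.coe_zero]] at h1
        exact Submodule.inclusion_injective hXY' (h1.symm.trans (map_zero _).symm))
    · exfalso
      have := (hP j).nontrivial
      have hPY : GRle (grMeasure Λ (P j)) (grMeasure Λ Y) :=
        grMeasure_le_of_injective (Y'.subtype ∘ₗ (P j).subtype)
          (Y'.subtype_injective.comp (P j).subtype_injective)
      obtain ⟨l, hl, hlI, hlk⟩ := grlt_iff.1 h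
      have hPlt : mlen Λ (P j) < m := by
        rw [← hYm]
        exact (mlen_le_of_injective (P j).subtype (P j).subtype_injective).trans_lt
          (Submodule.mlen_lt hY')
      have hlm := (grMeasure_subset hl).2
      rw [hXI] at hlI hlk
      refine GRlt.irrefl _ (GRlt.trans_le (grlt_iff.2 ⟨l, hl, ?_, fun i hi => ?_⟩) hPY)
      · rw [hμ]
        rintro (h | h)
        · omega
        · exact hlI h
      · rw [hμ, ← hlk i hi, Set.mem_insert_iff]
        have : i ≠ m := by omega
        tauto
    · refine ⟨(LinearEquiv.ofBijective _ h).symm.toLinearMap ∘ₗ p j, fun x hx => ?_⟩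
      exact (LinearEquiv.ofBijective _ h).symm_apply_apply ⟨x, hx⟩

theorem exists_isDirectSuccessor (hE : IsDualizing R E) {I J : Set ℕ}
    (hI : IsGRMeasureOf Λ I) (hJ : IsGRMeasureOf Λ J) (hIJ : GRlt I J) :
    ∃ K, IsDirectSuccessor Λ I K := by
  have : IsArtinianRing Λ := (isArtinian_isNoetherian_of_finite R (Λ := Λ) Λ).1
  have hbdd := bddAbove_setOf_isGRMeasureOf_insert hE hI
  set P := {m | m ∉ I ∧ IsGRMeasureOf Λ (insert m (I ∩ Set.Iio m))}
  have hne : P.Nonempty := by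
    obtain ⟨m, -, hmI, -, hm⟩ := hJ.exists_insert hIJ
    exact ⟨m, hmI, hm⟩
  obtain ⟨m, hm, hmax⟩ := hbdd.finite.exists_maximal hne
  refine ⟨_, hI, hm.2, grlt_iff.2 ⟨m, Or.inl rfl, hm.1, fun k hk => ?_⟩, ?_⟩
  · simp [hk, hk.ne]
  · rintro ⟨K, hK, hIK, hKm⟩
    obtain ⟨k, hkK, hkI, hk, hkP⟩ := hK.exists_insert hIK
    obtain ⟨l, hl, hlK, hlk⟩ := grlt_iff.1 hKm
    have hkm : k ≤ m := by
      by_contra h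
      exact h (hmax ⟨hkI, hkP⟩ (not_le.1 h).le)
    have hlm : l ≤ m := by
      rcases hl with rfl | h
      exacts [le_rfl, h.2.le]
    rcases hl with rfl | ⟨hlI, hlm⟩
    · rcases hkm.eq_or_lt with rfl | hkm
      · exact hlK hkK
      · rcases (hlk k hkm).1 hkK with h | h
        · omega
        · exact hkI h.1
    · rcases lt_trichotomy l k with h | rfl | h
      · exact hlK ((hk l h).1 hlI)
      · exact hlK hkK
      · rcases (hlk k h).1 hkK with h' | h'
        · have : l < m := hlm
          omega
        · exact hkI h'.1

end Successor

theorem exists_finset_forall_mem_imp_eq_zero {Λ : Type*} [Ring Λ] {M : Type*} [AddCommGroup M]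
    [Module Λ M] [IsArtinian Λ M] {ι : Type*} (K : ι → Submodule Λ M)
    (hK : ∀ x ≠ 0, ∃ i, x ∉ K i) : ∃ s : Finset ι, ∀ x, (∀ i ∈ s, x ∈ K i) → x = 0 := by
  classical
  obtain ⟨_, ⟨s, rfl⟩, hmin⟩ := IsArtinian.set_has_minimal
    (Set.range fun s : Finset ι => s.inf K) (Set.range_nonempty _)
  refine ⟨s, fun x hx => by_contra fun h0 => ?_⟩
  obtain ⟨i, hi⟩ := hK x h0
  refine hmin _ ⟨insert i s, rfl⟩ ?_
  refine lt_of_le_of_ne (Finset.inf_mono (Finset.subset_insert i s)) fun h => hi ?_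
  have hxs : x ∈ (insert i s).inf K := by
    rw [show (insert i s).inf K = s.inf K from h]
    exact Submodule.mem_finsetInf.2 hx
  exact Submodule.mem_finsetInf.1 hxs i (Finset.mem_insert_self i s)

section Measures

variable {Λ : Type u} [Ring Λ]

theorem BundledMod.IsFGIndec.isGRMeasureOf {Y : BundledMod Λ} (hY : Y.IsFGIndec) :
    IsGRMeasureOf Λ (grMeasure Λ Y.carrier) :=
  ⟨Y.carrier, inferInstance, inferInstance, hY.1, hY.2, rfl⟩

theorem IsGRMeasureOf.exists_bundledMod {I : Set ℕ} (hI : IsGRMeasureOf Λ I) :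
    ∃ Y : BundledMod Λ, Y.IsFGIndec ∧ grMeasure Λ Y.carrier = I := by
  obtain ⟨M, _, _, hfin, hM, h⟩ := hI
  exact ⟨⟨M⟩, ⟨hfin, hM⟩, h⟩

theorem Set.Finite.exists_mlen_le [IsArtinianRing Λ] {S : Set (Set ℕ)} (hS : S.Finite) :
    ∃ b, ∀ Y : BundledMod Λ, Y.IsFGIndec → grMeasure Λ Y.carrier ∈ S → mlen Λ Y.carrier ≤ b := by
  have hone (I : Set ℕ) : ∃ b, ∀ Y : BundledMod Λ, Y.IsFGIndec → grMeasure Λ Y.carrier = I →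
      mlen Λ Y.carrier ≤ b := by
    by_cases h : ∃ Y : BundledMod Λ, Y.IsFGIndec ∧ grMeasure Λ Y.carrier = I
    · obtain ⟨Y₀, hY₀, rfl⟩ := h
      have := hY₀.1
      have := hY₀.2.nontrivial
      refine ⟨mlen Λ Y₀.carrier, fun Y hY h => ?_⟩
      have := hY.1
      exact (grMeasure_subset (h ▸ mlen_mem_grMeasure hY.2)).2
    · exact ⟨0, fun Y hY hI => absurd ⟨Y, hY, hI⟩ h⟩
  choose b hb using hone
  obtain ⟨B, hB⟩ := (hS.image b).bddAbove
  exact ⟨B, fun Y hY hYS => (hb _ Y hY rfl).trans (hB ⟨_, hYS, rfl⟩)⟩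

theorem HasFiniteRepType.finite_setOf_isGRMeasureOf [IsArtinianRing Λ] (h : HasFiniteRepType Λ) :
    {I : Set ℕ | IsGRMeasureOf Λ I}.Finite := by
  obtain ⟨n, rep, hrep⟩ := h
  refine (Set.finite_range fun i => grMeasure Λ (rep i).carrier).subset ?_
  rintro _ ⟨M, _, _, hfg, hM, rfl⟩
  obtain ⟨i, ⟨e⟩⟩ := hrep M _ _ hfg hM
  have := hM.nontrivial
  exact ⟨i, e.grMeasure_eq.symm⟩

theorem isGRMeasureOf_singleton_one [IsArtinianRing Λ] [Nontrivial Λ] : IsGRMeasureOf Λ {1} := by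
  obtain ⟨m, hm⟩ := Ideal.exists_maximal Λ
  have : IsSimpleModule Λ (Λ ⧸ m) := isSimpleModule_iff_isCoatom.2 hm.out
  have := IsSimpleModule.nontrivial Λ (Λ ⧸ m)
  refine ⟨Λ ⧸ m, inferInstance, inferInstance, inferInstance,
    isIndecomposableModule_of_isSimpleModule, Set.Subset.antisymm ?_ ?_⟩
  · refine grMeasure_subset.trans ?_
    rw [mlen_eq_one]
    simp
  · simpa using one_mem_grMeasure

theorem IsGRMeasureOf.singleton_one_le [IsArtinianRing Λ] {I : Set ℕ} (hI : IsGRMeasureOf Λ I) :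
    GRle {1} I := by
  refine not_grlt.1 fun h => ?_
  obtain ⟨M, _, _, hfg, hM, rfl⟩ := hI
  have := hM.nontrivial
  obtain ⟨m, rfl, hm, -⟩ := grlt_iff.1 h
  exact hm one_mem_grMeasure

theorem isGRSegment_setOf_isGRMeasureOf [IsArtinianRing Λ] [Nontrivial Λ] :
    IsGRSegment Λ {I | IsGRMeasureOf Λ I} := by
  refine ⟨⟨_, isGRMeasureOf_singleton_one⟩, fun I hI => hI, fun I _ J hJ => ?_⟩
  rcases hJ with h | h
  exacts [h.2.1, h.1]

theorem IsDirectSuccessor.eq_of_lt_of_le {I J K : Set ℕ} (h : IsDirectSuccessor Λ I K)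
    (hJ : IsGRMeasureOf Λ J) (hIJ : GRlt I J) (hJK : GRle J K) : J = K :=
  hJK.resolve_right fun h' => h.2.2.2 ⟨J, hJ, hIJ, h'⟩

theorem isGRSegment_finite_initial [IsArtinianRing Λ] [Nontrivial Λ] :
    IsGRSegment Λ {I | IsGRMeasureOf Λ I ∧ {J | IsGRMeasureOf Λ J ∧ GRle J I}.Finite} := by
  refine ⟨⟨_, isGRMeasureOf_singleton_one, ?_⟩, fun I hI => hI.1, ?_⟩
  · refine (Set.finite_singleton {1}).subset fun J hJ => ?_
    exact hJ.2.antisymm (hJ.1.singleton_one_le)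
  · rintro I ⟨hI, hfin⟩ J (h | h)
    · refine ⟨h.2.1, (hfin.insert J).subset fun K hK => ?_⟩
      by_cases hIK : GRlt I K
      · exact Or.inl (h.eq_of_lt_of_le hK.1 hIK hK.2)
      · exact Or.inr ⟨hK.1, not_grlt.1 hIK⟩
    · exact ⟨h.1, hfin.subset fun K hK => ⟨hK.1, hK.2.trans h.2.2.1.le⟩⟩

end Measures

section Segments

variable {R Λ E : Type u} [CommRing R] [IsArtinianRing R] [Ring Λ] [Algebra R Λ]
  [Module.Finite R Λ] [AddCommGroup E] [Module R E]

theorem exists_finite_dominating_set (hE : IsDualizing R E) (A : BundledMod Λ → Prop) (b : ℕ)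
    (hA : ∀ Y : BundledMod Λ, Y.IsFGIndec → A Y → mlen Λ Y.carrier ≤ b) :
    ∃ 𝒴 : Set (BundledMod Λ), 𝒴.Finite ∧ (∀ Y ∈ 𝒴, Y.IsFGIndec) ∧
      ∀ X : BundledMod Λ, X.IsFGIndec → ∃ Y ∈ 𝒴,
        (¬ A Y ∧ GRlt (grMeasure Λ X.carrier) (grMeasure Λ Y.carrier)) ∨
          Nonempty (X.carrier ≃ₗ[Λ] Y.carrier) := by
  obtain ⟨𝒴, hfin, h𝒴, hdet⟩ := exists_finite_detecting_set hE A b hA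
  refine ⟨𝒴, hfin, h𝒴, fun X hX => ?_⟩
  by_cases hiso : ∃ Y ∈ 𝒴, Nonempty (X.carrier ≃ₗ[Λ] Y.carrier)
  · obtain ⟨Y, hY, h⟩ := hiso
    exact ⟨Y, hY, Or.inr h⟩
  have hnb : ∀ Y ∈ 𝒴, ∀ f : X.carrier →ₗ[Λ] Y.carrier, ¬ Function.Bijective f :=
    fun Y hY f hf => hiso ⟨Y, hY, ⟨LinearEquiv.ofBijective f hf⟩⟩
  have := hX.1
  obtain ⟨_, _⟩ := isArtinian_isNoetherian_of_finite R (Λ := Λ) X.carrier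
  obtain ⟨s, hs⟩ := exists_finset_forall_mem_imp_eq_zero
    (fun p : Σ Y : {Y // Y ∈ 𝒴 ∧ ¬ A Y}, X.carrier →ₗ[Λ] Y.1.carrier => LinearMap.ker p.2)
    (fun x hx => by
      obtain ⟨Y, hY, f, hf, h⟩ := hdet X hX x hx
      exact ⟨⟨⟨Y, hY, h.resolve_right (hnb Y hY f)⟩, f⟩, hf⟩)
  have hfg (p : s) : IsArtinian Λ p.1.1.1.carrier ∧ IsNoetherian Λ p.1.1.1.carrier :=
    have := (h𝒴 _ p.1.1.2.1).1
    isArtinian_isNoetherian_of_finite R _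
  have (p : s) := (hfg p).1
  have (p : s) := (hfg p).2
  obtain ⟨p, hp⟩ := exists_grMeasure_lt_or_bijective hX.2
    (fun p : s => (h𝒴 _ p.1.1.2.1).2) (fun p => p.1.2) (fun z hz => hs z fun i hi => hz ⟨i, hi⟩)
  exact ⟨p.1.1, p.1.1.2.1, Or.inl ⟨p.1.1.2.2, hp.resolve_right (hnb _ p.1.1.2.1 _)⟩⟩

theorem exists_isGRMeasureOf_max (hE : IsDualizing R E) (Q : Set ℕ → Prop)
    (hfin : {J | IsGRMeasureOf Λ J ∧ ¬ Q J}.Finite) (hne : ∃ J, IsGRMeasureOf Λ J ∧ Q J) :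
    ∃ J, IsGRMeasureOf Λ J ∧ Q J ∧ ∀ K, IsGRMeasureOf Λ K → Q K → GRle K J := by
  have : IsArtinianRing Λ := (isArtinian_isNoetherian_of_finite R (Λ := Λ) Λ).1
  obtain ⟨b, hb⟩ := hfin.exists_mlen_le (Λ := Λ)
  obtain ⟨𝒴, h𝒴fin, h𝒴, hdom⟩ := exists_finite_dominating_set hE
    (fun Y : BundledMod Λ => ¬ Q (grMeasure Λ Y.carrier)) b
    (fun Y hY hQ => hb Y hY ⟨hY.isGRMeasureOf, hQ⟩)
  have hdom' : ∀ K, IsGRMeasureOf Λ K → Q K →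
      ∃ Y ∈ 𝒴, Q (grMeasure Λ Y.carrier) ∧ GRle K (grMeasure Λ Y.carrier) := by
    intro K hK hQ
    obtain ⟨X, hX, rfl⟩ := hK.exists_bundledMod
    obtain ⟨Y, hY, ⟨hYQ, hlt⟩ | ⟨⟨e⟩⟩⟩ := hdom X hX
    · exact ⟨Y, hY, not_not.1 hYQ, hlt.le⟩
    · have := hX.1
      have := hX.2.nontrivial
      obtain ⟨_, _⟩ := isArtinian_isNoetherian_of_finite R (Λ := Λ) X.carrier
      have h := e.grMeasure_eq
      exact ⟨Y, hY, h ▸ hQ, Or.inl h⟩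
  obtain ⟨J₀, hJ₀, hQ₀⟩ := hne
  obtain ⟨Y₀, hY₀, hYQ₀, -⟩ := hdom' J₀ hJ₀ hQ₀
  obtain ⟨_, ⟨Y, ⟨hY, hYQ⟩, rfl⟩, hmax⟩ := Set.Finite.exists_gr_max
    ((h𝒴fin.subset (Set.sep_subset 𝒴 fun Y => Q (grMeasure Λ Y.carrier))).image
      fun Y : BundledMod Λ => grMeasure Λ Y.carrier) ⟨_, Y₀, ⟨hY₀, hYQ₀⟩, rfl⟩
  refine ⟨_, (h𝒴 Y hY).isGRMeasureOf, hYQ, fun K hK hQ => ?_⟩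
  obtain ⟨Z, hZ, hZQ, hKZ⟩ := hdom' K hK hQ
  exact hKZ.trans (hmax _ ⟨Z, ⟨hZ, hZQ⟩, rfl⟩)

theorem hasFiniteRepType_of_finite (hE : IsDualizing R E)
    (hfin : {I : Set ℕ | IsGRMeasureOf Λ I}.Finite) : HasFiniteRepType Λ := by
  have : IsArtinianRing Λ := (isArtinian_isNoetherian_of_finite R (Λ := Λ) Λ).1
  obtain ⟨b, hb⟩ := hfin.exists_mlen_le (Λ := Λ)
  obtain ⟨𝒴, h𝒴fin, -, hdom⟩ := exists_finite_dominating_set hE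
    (fun _ : BundledMod Λ => True) b (fun Y hY _ => hb Y hY hY.isGRMeasureOf)
  have := h𝒴fin.to_subtype
  obtain ⟨n, ⟨e⟩⟩ := Finite.exists_equiv_fin 𝒴
  refine ⟨n, fun i => e.symm i, fun M _ _ hfg hM => ?_⟩
  obtain ⟨Y, hY, ⟨h, -⟩ | h⟩ := hdom ⟨M⟩ ⟨hfg, hM⟩
  · exact absurd trivial h
  · exact ⟨e ⟨Y, hY⟩, by beta_reduce; rwa [e.symm_apply_apply]⟩

/-- A finite segment consists of all Gabriel–Roiter measures. -/
theorem IsGRSegment.eq_of_finite (hE : IsDualizing R E) {S : Set (Set ℕ)} (hS : IsGRSegment Λ S)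
    (hfin : S.Finite) : S = {I | IsGRMeasureOf Λ I} := by
  obtain ⟨hne, hGR, hcl⟩ := hS
  obtain ⟨i, hiS, hi⟩ := hfin.exists_gr_min hne
  have hup : ∀ J, IsGRMeasureOf Λ J → ¬ GRlt J i → J ∈ S := by
    intro J hJ hiJ
    by_contra hJS
    obtain ⟨s, ⟨hsS, hsJ⟩, hs⟩ :=
      Set.Finite.exists_gr_max (hfin.subset (Set.sep_subset S fun s => GRlt s J))
        ⟨i, hiS, (not_grlt.1 hiJ).resolve_left fun h => hJS (h ▸ hiS)⟩
    obtain ⟨K, hK⟩ := exists_isDirectSuccessor hE (hGR s hsS) hJ hsJ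
    have hKS := hcl s hsS K (Or.inl hK)
    have hKJ : GRlt K J := by
      by_contra h
      exact hJS (hK.eq_of_lt_of_le hJ hsJ (not_grlt.1 h) ▸ hKS)
    exact GRlt.irrefl _ (hK.2.2.1.trans_le (hs K ⟨hKS, hKJ⟩))
  refine Set.Subset.antisymm hGR fun J hJ => hup J hJ fun hJi => ?_
  obtain ⟨K, hK, hKi, hmax⟩ := exists_isGRMeasureOf_max hE (fun K => GRlt K i)
    (hfin.subset fun K hK => hup K hK.1 hK.2) ⟨J, hJ, hJi⟩
  have hsucc : IsDirectSuccessor Λ K i :=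
    ⟨hK, hGR i hiS, hKi, fun ⟨L, hL, hKL, hLi⟩ =>
      GRlt.irrefl _ (hKL.trans_le (hmax L hL hLi))⟩
  exact GRlt.irrefl _ (hKi.trans_le (hi K (hcl i hiS K (Or.inr hsucc))))

theorem finite_rep_type_tfae_of_isDualizing [Nontrivial Λ] (hE : IsDualizing R E) :
    List.TFAE
      [HasFiniteRepType Λ,
       {I : Set ℕ | IsGRMeasureOf Λ I}.Finite,
       ∃ S : Set (Set ℕ), IsGRSegment Λ S ∧ S.Finite,
       ∃! S : Set (Set ℕ), IsGRSegment Λ S] := by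
  have : IsArtinianRing Λ := (isArtinian_isNoetherian_of_finite R (Λ := Λ) Λ).1
  tfae_have 1 → 2 := fun h => h.finite_setOf_isGRMeasureOf
  tfae_have 2 → 1 := hasFiniteRepType_of_finite hE
  tfae_have 2 → 3 := fun h => ⟨_, isGRSegment_setOf_isGRMeasureOf, h⟩
  tfae_have 3 → 2 := fun ⟨S, hS, hfin⟩ => hS.eq_of_finite hE hfin ▸ hfin
  tfae_have 2 → 4 := fun h => ⟨_, isGRSegment_setOf_isGRMeasureOf, fun S hS =>
    hS.eq_of_finite hE (h.subset hS.2.1)⟩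
  tfae_have 4 → 2 := by
    intro h
    have heq := h.unique (isGRSegment_finite_initial (Λ := Λ)) (isGRSegment_setOf_isGRMeasureOf)
    obtain ⟨G, hG, -, hmax⟩ := exists_isGRMeasureOf_max hE (Λ := Λ) (fun _ => True) (by simp)
      ⟨_, isGRMeasureOf_singleton_one, trivial⟩
    have hG' : G ∈ {I | IsGRMeasureOf Λ I} := hG
    rw [← heq] at hG'
    exact hG'.2.subset fun J hJ => ⟨hJ, hmax J hJ trivial⟩
  tfae_finish

end Segments

/-- Let `Λ` be a nonzero artin algebra.  The following are equivalent:
(i) `Λ` has finite representation type;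
(ii) the set of GR measures for `Λ` is finite;
(iii) some GR segment for `Λ` is finite;
(iv) there is exactly one GR segment for `Λ`. -/
theorem finite_rep_type_tfae (R : Type*) [CommRing R] [IsArtinianRing R]
    (Λ : Type u) [Ring Λ] [Nontrivial Λ] [Algebra R Λ] [Module.Finite R Λ] :
    List.TFAE
      [HasFiniteRepType Λ,
       {I : Set ℕ | IsGRMeasureOf Λ I}.Finite,
       ∃ S : Set (Set ℕ), IsGRSegment Λ S ∧ S.Finite,
       ∃! S : Set (Set ℕ), IsGRSegment Λ S] := by
  let _ : Algebra (Subalgebra.center R Λ) Λ :=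
    { algebraMap := (Subalgebra.center R Λ).val.toRingHom
      commutes' := fun c x => (Subalgebra.mem_center_iff.1 c.2 x).symm
      smul_def' := fun _ _ => rfl }
  have : IsArtinianRing (Subalgebra.center R Λ) :=
    isArtinian_of_tower R (isArtinian_of_injective (Subalgebra.center R Λ).val.toLinearMap
      Subtype.val_injective)
  have : Module.Finite (Subalgebra.center R Λ) Λ :=
    Module.Finite.of_restrictScalars_finite R _ Λ
  obtain ⟨E, _, _, hE⟩ := exists_isDualizing (Subalgebra.center R Λ)
  exact finite_rep_type_tfae_of_isDualizing hE
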